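/- arXiv:2505.07092 — 4 statements merged into one kernel-verified Lean document; each statement's English description precedes it below -/
import Mathlib

section
/- Let p and q be primes with p ≡ 5 (mod 8), q ≡ 7 (mod 8) and Legendre symbol (p/q) = 1. Write the fundamental unit of ℚ(√(2pq)) as ε_{2pq} = x + y√(2pq) with x, y positive integers. Then p(x+1) is a perfect square in ℕ. -/
open Real

noncomputable section

/-- `e : ℝ` is a unit greater than `1` of the ring of integers of the real quadratic
field `ℚ(√d)`: it can be written as `(x + y√d)/2` with `x, y ≥ 1` integers satisfying
`x² - d·y² = ±4`. -/
def IsQuadUnit (d : ℕ) (e : ℝ) : Prop :=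
  ∃ x y : ℤ, 1 ≤ x ∧ 1 ≤ y ∧
    (x ^ 2 - (d : ℤ) * y ^ 2 = 4 ∨ x ^ 2 - (d : ℤ) * y ^ 2 = -4) ∧
    2 * e = (x : ℝ) + (y : ℝ) * Real.sqrt d

/-- `e` is the fundamental unit of the real quadratic field `ℚ(√d)` (for `d > 1`
squarefree), i.e. the smallest unit `> 1` of its ring of integers. -/
def IsFundamentalUnit (d : ℕ) (e : ℝ) : Prop :=
  IsQuadUnit d e ∧ ∀ e' : ℝ, IsQuadUnit d e' → e ≤ e'

/-- A unit `x + y√d` with `x, y` natural numbers and `d` not a square has norm `±1`. -/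
theorem IsQuadUnit.norm_eq {d x y : ℕ} (hd : ¬ IsSquare d)
    (h : IsQuadUnit d ((x : ℝ) + y * Real.sqrt d)) :
    (x : ℤ) ^ 2 - d * (y : ℤ) ^ 2 = 1 ∨ (x : ℤ) ^ 2 - d * (y : ℤ) ^ 2 = -1 := by
  obtain ⟨X, Y, -, -, hXY, he⟩ := h
  have hirr : Irrational (Real.sqrt d) := irrational_sqrt_natCast_iff.mpr hd
  have hlin : ((2 * y - Y : ℤ) : ℝ) * Real.sqrt d = ((X - 2 * x : ℤ) : ℝ) := by
    push_cast
    linarith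
  have hY : (2 * y - Y : ℤ) = 0 := by
    by_contra hne
    exact (hirr.intCast_mul hne).ne_int _ hlin
  have hX : (X - 2 * x : ℤ) = 0 := by
    rw [hY] at hlin
    have : ((X - 2 * x : ℤ) : ℝ) = 0 := by rw [← hlin]; simp
    exact_mod_cast this
  obtain rfl : Y = 2 * y := by linarith
  obtain rfl : X = 2 * x := by linarith
  rcases hXY with h | h
  · left; linarith
  · right; linarith

/-- A solution of the Pell equation `u² - d v² = 1` in positive integers gives a unit. -/
theorem IsQuadUnit.of_pell {d u v : ℕ} (hu : 0 < u) (hv : 0 < v)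
    (h : u ^ 2 = d * v ^ 2 + 1) : IsQuadUnit d ((u : ℝ) + v * Real.sqrt d) := by
  refine ⟨2 * u, 2 * v, by omega, by omega, Or.inl ?_, by push_cast; ring⟩
  have h' : (u : ℤ) ^ 2 = d * (v : ℤ) ^ 2 + 1 := by exact_mod_cast h
  linarith

/-- If the product of two coprime numbers is `n` times a square, then `n` factors as `k * l`
in such a way that the two numbers are `k` times a square and `l` times a square. -/
theorem Nat.Coprime.exists_eq_mul_sq_of_mul_eq_mul_sq {a b n z : ℕ} (hn : 0 < n)
    (hab : a.Coprime b) (h : a * b = n * z ^ 2) :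
    ∃ k l u v : ℕ, n = k * l ∧ a = k * u ^ 2 ∧ b = l * v ^ 2 := by
  have hg : 0 < a.gcd n := Nat.gcd_pos_of_pos_right a hn
  obtain ⟨a', ha'⟩ := Nat.gcd_dvd_left a n
  obtain ⟨l, hl⟩ := Nat.gcd_dvd_right a n
  have hcop : a'.Coprime l := by
    have := Nat.coprime_div_gcd_div_gcd hg
    rwa [Nat.div_eq_of_eq_mul_right hg ha', Nat.div_eq_of_eq_mul_right hg hl] at this
  generalize a.gcd n = k at *
  subst ha' hl
  have h' : a' * b = l * z ^ 2 := by
    apply Nat.eq_of_mul_eq_mul_left hg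
    linarith
  obtain ⟨b', rfl⟩ : l ∣ b := hcop.symm.dvd_of_dvd_mul_left ⟨_, h'⟩
  have hl0 : 0 < l := Nat.pos_of_mul_pos_left hn
  have hsq : a' * b' = z ^ 2 := by
    apply Nat.eq_of_mul_eq_mul_left hl0
    linarith
  have hcop' : a'.Coprime b' :=
    (hab.coprime_dvd_left (Dvd.intro_left _ rfl)).coprime_dvd_right (Dvd.intro_left _ rfl)
  obtain ⟨u, rfl⟩ := exists_eq_pow_of_mul_eq_pow (Nat.isUnit_iff.mpr hcop') hsq
  obtain ⟨v, rfl⟩ := exists_eq_pow_of_mul_eq_pow (Nat.isUnit_iff.mpr hcop'.symm)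
    (by rw [mul_comm]; exact hsq)
  exact ⟨k, l, u, v, rfl, rfl, rfl⟩

/-- In a commutative ring, an element whose product with a square is `1` is a square. -/
theorem isSquare_of_mul_sq_eq_one {R : Type*} [CommRing R] {c w : R} (h : c * w ^ 2 = 1) :
    IsSquare c :=
  ⟨c * w, by linear_combination (-c) * h⟩

/-- The divisors of a product `2 * p * q` with `p` and `q` prime. -/
theorem eq_of_dvd_two_mul_prime_mul_prime {p q k : ℕ} (hp : p.Prime) (hq : q.Prime)
    (h : k ∣ 2 * p * q) :
    k = 1 ∨ k = 2 ∨ k = p ∨ k = q ∨ k = 2 * p ∨ k = 2 * q ∨ k = p * q ∨ k = 2 * p * q := by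
  obtain ⟨m, c, hm, hc, rfl⟩ := (Nat.dvd_mul).mp h
  obtain ⟨a, b, ha, hb, rfl⟩ := (Nat.dvd_mul).mp hm
  rcases (Nat.dvd_prime Nat.prime_two).mp ha with rfl | rfl <;>
  rcases (Nat.dvd_prime hp).mp hb with rfl | rfl <;>
  rcases (Nat.dvd_prime hq).mp hc with rfl | rfl <;> simp

/-- For primes `p ≡ 5` and `q ≡ 7` modulo `8` with `(p/q) = 1`, the equation
`k u² - l v² = 1` with `k l = 2 p q` is solvable only for `k = 1` and `k = 2 p`. -/
theorem eq_one_or_eq_two_mul_of_mul_sq_eq {p q : ℕ} (hp : p.Prime) (hq : q.Prime)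
    (hp8 : p % 8 = 5) (hq8 : q % 8 = 7) (hleg : @legendreSym q ⟨hq⟩ (p : ℤ) = 1)
    {k l u v : ℕ} (hkl : 2 * p * q = k * l) (h : k * u ^ 2 = l * v ^ 2 + 1) :
    k = 1 ∨ k = 2 * p := by
  have : Fact p.Prime := ⟨hp⟩
  have : Fact q.Prime := ⟨hq⟩
  have hpq : (p : ZMod q) ≠ 0 := by
    intro h0
    have := (Nat.prime_dvd_prime_iff_eq hq hp).mp ((ZMod.natCast_eq_zero_iff p q).mp h0)
    omega
  have hp_sq : IsSquare (p : ZMod q) := (legendreSym.eq_one_iff' q hpq).mp hleg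
  have hq_sq : IsSquare (q : ZMod p) :=
    (ZMod.exists_sq_eq_prime_iff_of_mod_four_eq_one (by omega) (by omega)).mpr hp_sq
  have hneg_p : IsSquare (-1 : ZMod p) := ZMod.exists_sq_eq_neg_one_iff.mpr (by omega)
  have htwo_q : IsSquare (2 : ZMod q) := (ZMod.exists_sq_eq_two_iff (by omega)).mpr (by omega)
  have htwo_p : ∀ w : ZMod p, 2 * w ^ 2 ≠ 1 := fun w hw => by
    have := (ZMod.exists_sq_eq_two_iff (by omega)).mp (isSquare_of_mul_sq_eq_one hw)
    omega
  have hneg_q : ∀ w : ZMod q, -1 * w ^ 2 ≠ 1 := fun w hw => by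
    have := ZMod.exists_sq_eq_neg_one_iff.mp (isSquare_of_mul_sq_eq_one hw)
    omega
  have hmod_p := congrArg (Nat.cast : ℕ → ZMod p) h
  have hmod_q := congrArg (Nat.cast : ℕ → ZMod q) h
  obtain ⟨r, hr⟩ := hp_sq
  obtain ⟨s, hs⟩ := hq_sq
  obtain ⟨i, hi⟩ := hneg_p
  obtain ⟨t, ht⟩ := htwo_q
  have hp0 := hp.pos
  have hq0 := hq.pos
  rcases eq_of_dvd_two_mul_prime_mul_prime hp hq ⟨l, hkl⟩ with
    rfl | rfl | rfl | rfl | rfl | rfl | rfl | rfl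
  · exact Or.inl rfl
  · obtain rfl : l = p * q := Nat.eq_of_mul_eq_mul_left two_pos (by linarith)
    push_cast [CharP.cast_eq_zero] at hmod_p
    exact absurd (by linear_combination hmod_p) (htwo_p u)
  · obtain rfl : l = 2 * q := Nat.eq_of_mul_eq_mul_left hp0 (by linarith)
    push_cast [CharP.cast_eq_zero] at hmod_p
    rw [hs] at hmod_p
    exact absurd (by linear_combination hmod_p - 2 * s ^ 2 * v ^ 2 * hi) (htwo_p (i * s * v))
  · obtain rfl : l = 2 * p := Nat.eq_of_mul_eq_mul_left hq0 (by linarith)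
    push_cast [CharP.cast_eq_zero] at hmod_q
    rw [hr, ht] at hmod_q
    exact absurd (by linear_combination hmod_q) (hneg_q (t * r * v))
  · exact Or.inr rfl
  · obtain rfl : l = p := Nat.eq_of_mul_eq_mul_left (Nat.mul_pos two_pos hq0) (by linarith)
    push_cast [CharP.cast_eq_zero] at hmod_p
    rw [hs] at hmod_p
    exact absurd (by linear_combination hmod_p) (htwo_p (s * u))
  · obtain rfl : l = 2 := Nat.eq_of_mul_eq_mul_left (Nat.mul_pos hp0 hq0) (by linarith)
    push_cast [CharP.cast_eq_zero] at hmod_q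
    rw [ht] at hmod_q
    exact absurd (by linear_combination hmod_q) (hneg_q (t * v))
  · obtain rfl : l = 1 :=
      Nat.eq_of_mul_eq_mul_left (Nat.mul_pos (Nat.mul_pos two_pos hp0) hq0) (by linarith)
    push_cast [CharP.cast_eq_zero] at hmod_q
    exact absurd (by linear_combination hmod_q) (hneg_q v)

/-- Let `p ≡ 5 (mod 8)` and `q ≡ 7 (mod 8)` be primes with Legendre symbol `(p/q) = 1`.
Write the fundamental unit of `ℚ(√(2pq))` as `ε_{2pq} = x + y√(2pq)` with `x, y`
positive integers.  Then `p(x+1)` is a perfect square in `ℕ`. -/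
theorem statement_0 (p q : ℕ) (hp : p.Prime) (hq : q.Prime)
    (hp8 : p % 8 = 5) (hq8 : q % 8 = 7)
    (hleg : @legendreSym q ⟨hq⟩ (p : ℤ) = 1)
    (x y : ℕ) (hx : 0 < x) (hy : 0 < y)
    (hfund : IsFundamentalUnit (2 * p * q)
      ((x : ℝ) + (y : ℝ) * Real.sqrt (2 * p * q))) :
    ∃ n : ℕ, p * (x + 1) = n ^ 2 := by
  have hmod : 2 * p * q % 4 = 2 := by
    have : p * q % 2 = 1 := by
      rw [Nat.mul_mod]
      simp [show p % 2 = 1 by omega, show q % 2 = 1 by omega]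
    rw [mul_assoc]
    omega
  have hcast : (2 * p * q : ℝ) = ((2 * p * q : ℕ) : ℝ) := by push_cast; ring
  rw [hcast] at hfund
  generalize hd : 2 * p * q = d at hfund hmod
  have hnsq : ¬ IsSquare d := by
    rintro ⟨r, rfl⟩
    rw [Nat.mul_mod] at hmod
    have : r % 4 < 4 := Nat.mod_lt _ (by norm_num)
    interval_cases r % 4 <;> omega
  have hpell : x ^ 2 = d * y ^ 2 + 1 := by
    rcases hfund.1.norm_eq hnsq with h | h
    · have h' : (x : ℤ) ^ 2 = d * (y : ℤ) ^ 2 + 1 := by linarith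
      exact_mod_cast h'
    · have : Fact q.Prime := ⟨hq⟩
      have h' := congrArg (Int.cast : ℤ → ZMod q) h
      rw [← hd] at h'
      push_cast [CharP.cast_eq_zero] at h'
      exact absurd (ZMod.mod_four_ne_three_of_sq_eq_neg_one (p := q) (y := (x : ZMod q))
        (by linear_combination h')) (by omega)
  obtain ⟨e, he⟩ : ∃ e, d = 2 * e := ⟨d / 2, by omega⟩
  obtain ⟨a, rfl⟩ : Odd x := by
    rw [← Nat.odd_pow_iff two_ne_zero, hpell, he]
    exact ⟨e * y ^ 2, by ring⟩
  obtain ⟨z, rfl⟩ : 2 ∣ y := by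
    have hey : 2 * (a * (a + 1)) = e * y ^ 2 := by rw [he] at hpell; linarith
    have he2 : Nat.Coprime 2 e := (Nat.coprime_two_left).mpr (Nat.odd_iff.mpr (by omega))
    exact Nat.prime_two.dvd_of_dvd_pow (he2.dvd_of_dvd_mul_left ⟨_, hey.symm⟩)
  have hprod : (a + 1) * a = d * z ^ 2 := by linarith
  obtain ⟨k, l, u, v, hkl, hk, hl⟩ := Nat.Coprime.exists_eq_mul_sq_of_mul_eq_mul_sq
    (by omega) (by simp) hprod
  rcases eq_one_or_eq_two_mul_of_mul_sq_eq hp hq hp8 hq8 hleg (hd.trans hkl)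
    (by rw [← hk, ← hl]) with rfl | rfl
  · obtain rfl : d = l := by linarith
    exfalso
    have hd0 : 0 < d := by omega
    have hz0 : 0 < z := by omega
    have ha : 0 < a := by
      have : 0 < (a + 1) * a := by rw [hprod]; positivity
      exact Nat.pos_of_mul_pos_left this
    have hu : 0 < u := Nat.pos_of_ne_zero (by rintro rfl; simp at hk)
    have hv : 0 < v := Nat.pos_of_ne_zero (by rintro rfl; simp at hl; omega)
    have hle := hfund.2 _ (IsQuadUnit.of_pell hu hv (by linarith))
    have hxu : u < 2 * a + 1 := by nlinarith
    have hzv : v ≤ 2 * z := by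
      have : v ^ 2 ≤ z ^ 2 := Nat.le_of_mul_le_mul_left (by rw [← hprod, ← hl]; nlinarith) hd0
      nlinarith
    have hxu' : (u : ℝ) < (2 * a + 1 : ℕ) := by exact_mod_cast hxu
    have hzv' : (v : ℝ) ≤ (2 * z : ℕ) := by exact_mod_cast hzv
    have := mul_le_mul_of_nonneg_right hzv' (Real.sqrt_nonneg d)
    linarith
  · exact ⟨2 * p * u, by linear_combination 2 * p * hk⟩
end
end

section
/- Let p and q be primes with p ≡ 5 (mod 8), q ≡ 7 (mod 8) and Legendre symbol (p/q) = 1. Write the fundamental unit of ℚ(√(pq)) as ε_{pq} = a + b√(pq) with a, b positive integers. Then 2p(a+1) is a perfect square in ℕ. -/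
open Real

noncomputable section

theorem Nat.Coprime.exists_sq_of_mul_eq_sq {u v c : ℕ} (h : u.Coprime v) (huv : u * v = c ^ 2) :
    ∃ y z : ℕ, u = y ^ 2 ∧ v = z ^ 2 ∧ c = y * z := by
  obtain ⟨y, hy⟩ := exists_eq_pow_of_mul_eq_pow (Nat.isUnit_iff.2 h) huv
  obtain ⟨z, hz⟩ := exists_eq_pow_of_mul_eq_pow (Nat.isUnit_iff.2 h.symm) ((mul_comm v u).trans huv)
  refine ⟨y, z, hy, hz, ?_⟩
  have : c ^ 2 = (y * z) ^ 2 := by rw [← huv, hy, hz, mul_pow]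
  exact Nat.pow_left_injective two_ne_zero this

theorem Nat.Coprime.exists_prime_mul_split {p u v m : ℕ} (hp : p.Prime) (h : u.Coprime v)
    (huv : u * v = p * m) :
    (∃ w : ℕ, u = p * w ∧ w.Coprime v ∧ w * v = m) ∨
      ∃ w : ℕ, v = p * w ∧ u.Coprime w ∧ u * w = m := by
  rcases hp.dvd_mul.1 (Dvd.intro m huv.symm) with ⟨w, rfl⟩ | ⟨w, rfl⟩
  · refine .inl ⟨w, rfl, h.coprime_mul_left, ?_⟩
    exact Nat.eq_of_mul_eq_mul_left hp.pos (by rw [← huv]; ring)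
  · refine .inr ⟨w, rfl, h.coprime_mul_left_right, ?_⟩
    exact Nat.eq_of_mul_eq_mul_left hp.pos (by rw [← huv]; ring)

theorem Nat.Coprime.exists_of_mul_eq_prime_mul_prime_mul_sq {p q u v c : ℕ} (hp : p.Prime)
    (hq : q.Prime) (h : u.Coprime v) (huv : u * v = p * (q * c ^ 2)) :
    ∃ y z : ℕ, c = y * z ∧
      ((u = y ^ 2 ∧ v = p * (q * z ^ 2)) ∨ (u = p * (q * y ^ 2) ∧ v = z ^ 2) ∨
        (u = p * y ^ 2 ∧ v = q * z ^ 2) ∨ (u = q * y ^ 2 ∧ v = p * z ^ 2)) := by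
  rcases h.exists_prime_mul_split hp huv with ⟨w, rfl, hc, hw⟩ | ⟨w, rfl, hc, hw⟩ <;>
  rcases hc.exists_prime_mul_split hq hw with ⟨t, rfl, hd, ht⟩ | ⟨t, rfl, hd, ht⟩ <;>
  obtain ⟨y, z, rfl, rfl, rfl⟩ := hd.exists_sq_of_mul_eq_sq ht <;>
  exact ⟨y, z, rfl, by simp⟩

/-- If `p ≡ 5 (mod 8)` and `q` is a square modulo `p`, then no two coprime numbers that differ by
`2` have a product of the form `p q c²`. -/
theorem not_mul_add_two_eq_prime_mul_prime_mul_sq {p q v c : ℕ} (hp : p.Prime) (hq : q.Prime)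
    (hp8 : p % 8 = 5) (hsq : IsSquare (q : ZMod p)) (h : (v + 2).Coprime v) :
    (v + 2) * v ≠ p * (q * c ^ 2) := by
  intro huv
  have : Fact p.Prime := ⟨hp⟩
  have hp2 : p ≠ 2 := by omega
  have h2 : ¬ IsSquare (2 : ZMod p) := by rw [ZMod.exists_sq_eq_two_iff hp2]; omega
  have hn2 : ¬ IsSquare (-2 : ZMod p) := by rw [ZMod.exists_sq_eq_neg_two_iff hp2]; omega
  obtain ⟨s, hs⟩ := hsq
  obtain ⟨y, z, -, ⟨hu, hv⟩ | ⟨hu, hv⟩ | ⟨hu, hv⟩ | ⟨hu, hv⟩⟩ :=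
    h.exists_of_mul_eq_prime_mul_prime_mul_sq hp hq huv <;>
  · apply_fun ((↑) : ℕ → ZMod p) at hu hv
    push_cast at hu hv
    simp only [CharP.cast_eq_zero, zero_mul, hs] at hu hv
    first
    | exact h2 ⟨y, by linear_combination hu - hv⟩
    | exact h2 ⟨s * y, by linear_combination hu - hv⟩
    | exact hn2 ⟨z, by linear_combination hv - hu⟩
    | exact hn2 ⟨s * z, by linear_combination hv - hu⟩

/-- If `q ≡ 3 (mod 4)` and `p` is a square modulo `q`, then consecutive numbers with product
`p q c²` are of the form `(y², p q z²)` or `(p y², q z²)`, the larger one being listed first. -/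
theorem exists_of_mul_succ_eq_prime_mul_prime_mul_sq {p q v c : ℕ} (hp : p.Prime) (hq : q.Prime)
    (hq4 : q % 4 = 3) (hsq : IsSquare (p : ZMod q)) (huv : (v + 1) * v = p * (q * c ^ 2)) :
    ∃ y z : ℕ, c = y * z ∧
      ((v + 1 = y ^ 2 ∧ v = p * (q * z ^ 2)) ∨ (v + 1 = p * y ^ 2 ∧ v = q * z ^ 2)) := by
  have : Fact q.Prime := ⟨hq⟩
  have hn1 : ¬ IsSquare (-1 : ZMod q) := by rw [ZMod.exists_sq_eq_neg_one_iff]; omega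
  obtain ⟨s, hs⟩ := hsq
  obtain ⟨y, z, hc, h | ⟨hu, hv⟩ | h | ⟨hu, hv⟩⟩ :=
    Nat.Coprime.exists_of_mul_eq_prime_mul_prime_mul_sq hp hq (by simp) huv
  · exact ⟨y, z, hc, .inl h⟩
  · apply_fun ((↑) : ℕ → ZMod q) at hu hv
    push_cast at hu hv
    simp only [CharP.cast_eq_zero, zero_mul, mul_zero] at hu hv
    exact absurd ⟨z, by linear_combination hv - hu⟩ hn1
  · exact ⟨y, z, hc, .inr h⟩
  · apply_fun ((↑) : ℕ → ZMod q) at hu hv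
    push_cast at hu hv
    simp only [CharP.cast_eq_zero, zero_mul, hs] at hu hv
    exact absurd ⟨s * z, by linear_combination hv - hu⟩ hn1

theorem int_eq_of_add_mul_sqrt_eq {d : ℕ} (hd : ¬ IsSquare d) {x y x' y' : ℤ}
    (h : (x : ℝ) + y * √d = x' + y' * √d) : x = x' ∧ y = y' := by
  have hirr : Irrational √(d : ℝ) := irrational_sqrt_natCast_iff.2 hd
  have hy : y = y' := by
    by_contra hne
    have h0 : y - y' ≠ 0 := sub_ne_zero.2 hne
    refine (hirr.intCast_mul h0).ne_int (x' - x) ?_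
    push_cast
    linear_combination h
  subst hy
  exact ⟨by exact_mod_cast add_right_cancel h, rfl⟩

theorem not_isSquare_of_mod_eight_eq_three {d : ℕ} (hd : d % 8 = 3) : ¬ IsSquare d := by
  rintro ⟨n, rfl⟩
  have : n % 8 < 8 := Nat.mod_lt _ (by norm_num)
  rw [Nat.mul_mod] at hd
  interval_cases n % 8 <;> omega

theorem not_dvd_sq_add_one {q a : ℕ} (hq : q.Prime) (hq4 : q % 4 = 3) : ¬ q ∣ a ^ 2 + 1 := by
  intro h
  have : Fact q.Prime := ⟨hq⟩
  have h0 : ((a ^ 2 + 1 : ℕ) : ZMod q) = 0 := (ZMod.natCast_eq_zero_iff _ _).2 h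
  push_cast at h0
  have := ZMod.exists_sq_eq_neg_one_iff.1 ⟨(a : ZMod q), by linear_combination -h0⟩
  omega

/-- Let `p ≡ 5 (mod 8)` and `q ≡ 7 (mod 8)` be primes with Legendre symbol `(p/q) = 1`.
Write the fundamental unit of `ℚ(√(pq))` as `ε_{pq} = a + b√(pq)` with `a, b`
positive integers.  Then `2p(a+1)` is a perfect square in `ℕ`. -/
theorem statement_2 (p q : ℕ) (hp : p.Prime) (hq : q.Prime)
    (hp8 : p % 8 = 5) (hq8 : q % 8 = 7)
    (hleg : @legendreSym q ⟨hq⟩ (p : ℤ) = 1)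
    (a b : ℕ) (ha : 0 < a) (hb : 0 < b)
    (hfund : IsFundamentalUnit (p * q)
      ((a : ℝ) + (b : ℝ) * Real.sqrt (p * q))) :
    ∃ n : ℕ, 2 * p * (a + 1) = n ^ 2 := by
  have : Fact q.Prime := ⟨hq⟩
  have : Fact p.Prime := ⟨hp⟩
  have hd8 : p * q % 8 = 3 := by rw [Nat.mul_mod, hp8, hq8]
  have hpq : ((p : ℕ) : ZMod q) ≠ 0 := fun h0 ↦ by
    rw [(legendreSym.eq_zero_iff q p).2 (by exact_mod_cast h0)] at hleg
    exact zero_ne_one hleg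
  have hsq : IsSquare (p : ZMod q) := by
    exact_mod_cast (legendreSym.eq_one_iff q (by exact_mod_cast hpq)).1 hleg
  have hsq' : IsSquare (q : ZMod p) :=
    (ZMod.exists_sq_eq_prime_iff_of_mod_four_eq_one (by omega) (by omega)).2 hsq
  obtain ⟨⟨x, y, -, -, hnorm, hxy⟩, hmin⟩ := hfund
  rw [← Nat.cast_mul] at hxy hmin
  obtain ⟨rfl, rfl⟩ : 2 * (a : ℤ) = x ∧ 2 * (b : ℤ) = y := by
    apply int_eq_of_add_mul_sqrt_eq (not_isSquare_of_mod_eight_eq_three hd8)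
    push_cast at hxy ⊢
    linear_combination hxy
  have hpell : a ^ 2 = p * (q * b ^ 2) + 1 := by
    rcases hnorm with h | h
    · zify
      push_cast at h
      linarith
    · have h' : a ^ 2 + 1 = q * (p * b ^ 2) := by
        zify
        push_cast at h
        linarith
      exact absurd ⟨_, h'⟩ (not_dvd_sq_add_one hq (by omega))
  rcases Nat.even_or_odd' a with ⟨k, rfl | rfl⟩
  · obtain ⟨v, hv⟩ : ∃ v, 2 * k = v + 1 := ⟨2 * k - 1, by omega⟩
    refine absurd ?_ (not_mul_add_two_eq_prime_mul_prime_mul_sq (v := v) (c := b) hp hq hp8 hsq' ?_)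
    · rw [hv] at hpell
      linarith
    · rw [Nat.coprime_self_add_left, Nat.coprime_two_left, Nat.odd_iff]
      omega
  · have hbe : Even b := by
      by_contra hodd
      have hO : Odd (p * (q * b ^ 2)) :=
        (Nat.odd_iff.2 (by omega)).mul
          ((Nat.odd_iff.2 (by omega)).mul (Nat.not_even_iff_odd.1 hodd).pow)
      have hE : Odd ((2 * k + 1) ^ 2) := Odd.pow ⟨k, rfl⟩
      rw [hpell] at hE
      exact Nat.not_even_iff_odd.2 hE hO.add_one
    obtain ⟨c, rfl⟩ := hbe.two_dvd
    have huv : (k + 1) * k = p * (q * c ^ 2) := by linarith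
    obtain ⟨y, z, rfl, ⟨hu, hv⟩ | ⟨hu, hv⟩⟩ :=
      exists_of_mul_succ_eq_prime_mul_prime_mul_sq hp hq (by omega) hsq huv
    · exfalso
      have hy : 0 < y := Nat.pos_of_ne_zero (by rintro rfl; simp at hb)
      have hz : 0 < z := Nat.pos_of_ne_zero (by rintro rfl; simp at hb)
      have hk : 0 < k := hv ▸ Nat.mul_pos hp.pos (Nat.mul_pos hq.pos (pow_pos hz 2))
      have hle := hmin ((y : ℝ) + z * √(p * q : ℕ))
        ⟨2 * y, 2 * z, by omega, by omega, .inl ?_, by push_cast; ring⟩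
      · have hlt : (y : ℝ) < ((2 * k + 1 : ℕ) : ℝ) := by
          exact_mod_cast (by nlinarith : y < 2 * k + 1)
        have hle' : (z : ℝ) ≤ ((2 * (y * z) : ℕ) : ℝ) := by
          exact_mod_cast (by nlinarith : z ≤ 2 * (y * z))
        have := mul_le_mul_of_nonneg_right hle' (Real.sqrt_nonneg ((p * q : ℕ) : ℝ))
        linarith
      · rw [hv] at hu
        zify at hu
        push_cast
        linarith
    · exact ⟨2 * p * y, by linear_combination 4 * p * hu⟩
end
end

section
/- Let p and q be primes with p ≡ 5 (mod 8), q ≡ 7 (mod 8) and Legendre symbol (p/q) = 1. Write the fundamental unit of ℚ(√(pq)) as ε_{pq} = a + b√(pq) with a, b positive integers. Then there exist integers b₁ and b₂ such that a + 1 = 2p·b₁² and a − 1 = 2q·b₂²; in particular 1 = p·b₁² − q·b₂² and (b₁√p + b₂√q)² = ε_{pq} in ℝ. -/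
open Real

noncomputable section

/-- A factorization of `d * c ^ 2` into coprime factors splits `d` and `c` accordingly. -/
theorem Nat.Coprime.exists_eq_mul_sq {m n d c : ℕ} (hmn : m.Coprime n) (hd : 0 < d)
    (h : m * n = d * c ^ 2) :
    ∃ u v s t : ℕ, u * v = d ∧ m = u * s ^ 2 ∧ n = v * t ^ 2 ∧ c = s * t := by
  have huv : d.gcd m * d.gcd n = d := by
    rw [← Nat.Coprime.gcd_mul d hmn, h]
    exact Nat.gcd_eq_left (Dvd.intro _ rfl)
  obtain ⟨m', hm⟩ := Nat.gcd_dvd_right d m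
  obtain ⟨n', hn⟩ := Nat.gcd_dvd_right d n
  generalize d.gcd m = u at *
  generalize d.gcd n = v at *
  subst hm hn huv
  have hsq : m' * n' = c ^ 2 := by
    apply Nat.eq_of_mul_eq_mul_left hd
    rw [← h]; ring
  have hco : m'.Coprime n' :=
    (hmn.coprime_dvd_left (Dvd.intro_left _ rfl)).coprime_dvd_right (Dvd.intro_left _ rfl)
  obtain ⟨s, rfl⟩ := exists_eq_pow_of_mul_eq_pow (Nat.isUnit_iff.2 hco) hsq
  obtain ⟨t, rfl⟩ := exists_eq_pow_of_mul_eq_pow (Nat.isUnit_iff.2 hco.symm)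
    ((mul_comm _ _).trans hsq)
  refine ⟨u, v, s, t, rfl, rfl, rfl, ?_⟩
  rw [← mul_pow] at hsq
  exact (Nat.pow_left_injective two_ne_zero hsq).symm

theorem Nat.Prime.eq_of_mul_eq_mul {p q u v : ℕ} (hp : p.Prime) (hq : q.Prime)
    (h : u * v = p * q) :
    (u = 1 ∧ v = p * q) ∨ (u = p * q ∧ v = 1) ∨ (u = p ∧ v = q) ∨ (u = q ∧ v = p) := by
  rcases (Nat.Prime.dvd_mul hp).1 (h ▸ Dvd.intro _ rfl : p ∣ u * v) with ⟨w, rfl⟩ | ⟨w, rfl⟩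
  · have hw : w * v = q := Nat.eq_of_mul_eq_mul_left hp.pos (by rw [← h]; ring)
    rcases (Nat.dvd_prime hq).1 (Dvd.intro _ hw) with rfl | rfl
    · simp_all
    · have : v = 1 := Nat.eq_of_mul_eq_mul_left hq.pos (by rw [hw, mul_one])
      simp_all
  · have hw : u * w = q := Nat.eq_of_mul_eq_mul_left hp.pos (by rw [← h]; ring)
    rcases (Nat.dvd_prime hq).1 (Dvd.intro _ hw) with rfl | rfl
    · simp_all
    · have : w = 1 := Nat.eq_of_mul_eq_mul_left hq.pos (by rw [hw, mul_one])
      simp_all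

theorem Nat.mul_sq_mod_eight_of_odd {s : ℕ} (hs : s % 2 = 1) (u : ℕ) :
    u * s ^ 2 % 8 = u % 8 := by
  have hs8 : s % 8 = 1 ∨ s % 8 = 3 ∨ s % 8 = 5 ∨ s % 8 = 7 := by omega
  rcases hs8 with h | h | h | h <;> simp [Nat.mul_mod, Nat.pow_mod, h]

theorem Nat.sq_mod_four (s : ℕ) : s ^ 2 % 4 = 0 ∨ s ^ 2 % 4 = 1 := by
  have : s % 4 = 0 ∨ s % 4 = 1 ∨ s % 4 = 2 ∨ s % 4 = 3 := by omega
  rcases this with h | h | h | h <;> simp [Nat.pow_mod, h]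

/-- `x + y√d` determines `x` and `y` when `√d` is irrational. -/
theorem Irrational.int_coords_unique {r : ℝ} (hr : Irrational r) {x y x' y' : ℤ}
    (h : (x : ℝ) + y * r = x' + y' * r) : x = x' ∧ y = y' := by
  have hy : y = y' := by
    by_contra hne
    have hne' : y - y' ≠ 0 := sub_ne_zero.2 hne
    apply (hr.intCast_mul hne').ne_int (x' - x)
    push_cast
    linarith
  subst hy
  exact ⟨by exact_mod_cast add_right_cancel h, rfl⟩

theorem Nat.mul_sq_ne_mul_sq_add_one {u v : ℕ} (hu : u % 4 = 3) (hv : v % 4 = 1) (s t : ℕ) :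
    u * s ^ 2 ≠ v * t ^ 2 + 1 := by
  intro h
  have h1 := Nat.mul_mod u (s ^ 2) 4
  have h2 := Nat.mul_mod v (t ^ 2) 4
  rw [hu] at h1
  rw [hv] at h2
  rcases Nat.sq_mod_four s with hs | hs <;> rcases Nat.sq_mod_four t with ht | ht <;>
    rw [hs] at h1 <;> rw [ht] at h2 <;> omega

/-- A unit `a + b√d` with `d ≡ 3 (mod 4)` and integral coordinates solves Pell's equation. -/
theorem IsQuadUnit.pell {d a b : ℕ} (hd : d % 4 = 3)
    (h : IsQuadUnit d ((a : ℝ) + b * √(d : ℝ))) : a ^ 2 = d * b ^ 2 + 1 := by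
  obtain ⟨x, y, -, -, hn, he⟩ := h
  have hirr : Irrational √(d : ℝ) := by
    rw [irrational_sqrt_natCast_iff]
    rintro ⟨r, rfl⟩
    have := Nat.sq_mod_four r
    rw [sq] at this
    omega
  obtain ⟨rfl, rfl⟩ := hirr.int_coords_unique (x := 2 * a) (y := 2 * b) (x' := x) (y' := y)
    (by push_cast; linarith)
  rcases hn with hn | hn
  · zify; linarith
  · exact absurd (show d * b ^ 2 = 1 * a ^ 2 + 1 by zify; linarith)
      (Nat.mul_sq_ne_mul_sq_add_one hd rfl b a)

/-- The fundamental unit is not the square of a unit `s + t√d` of norm `1`. -/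
theorem IsFundamentalUnit.not_sq {d a b s t : ℕ} (hd : 0 < d) (ht : 0 < t)
    (h : IsFundamentalUnit d ((a : ℝ) + b * √(d : ℝ))) (hst : s ^ 2 = d * t ^ 2 + 1)
    (ha : a + 1 = 2 * s ^ 2) (hb : b = 2 * (s * t)) : False := by
  have hs : 0 < s := by
    rcases Nat.eq_zero_or_pos s with rfl | hs
    · simp at ha
    · exact hs
  have hle := h.2 (s + t * √(d : ℝ)) ⟨2 * s, 2 * t, by omega, by omega,
    Or.inl (by zify at hst; linear_combination 4 * hst), by push_cast; ring⟩
  have hbt : t < b := by rw [hb]; nlinarith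
  have has : s ≤ a := by nlinarith
  have hr : 0 < √(d : ℝ) := Real.sqrt_pos.2 (by exact_mod_cast hd)
  have hbt' : (t : ℝ) < b := by exact_mod_cast hbt
  have has' : (s : ℝ) ≤ a := by exact_mod_cast has
  nlinarith

theorem Nat.Prime.not_isSquare_neg_two {p : ℕ} (hp : p.Prime) (h2 : p % 8 = 5 ∨ p % 8 = 7) :
    ¬ IsSquare (-2 : ZMod p) := by
  have := Fact.mk hp
  rw [ZMod.exists_sq_eq_neg_two_iff (by rintro rfl; omega)]
  omega

/-- In a solution of `a ^ 2 = p * q * b ^ 2 + 1` the number `a = k + 1` is odd. -/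
theorem even_of_mul_add_two_eq {p q k b : ℕ} (hp : p.Prime) (hq : q.Prime)
    (hp8 : p % 8 = 5) (hq8 : q % 8 = 7) (hsq : IsSquare (p : ZMod q))
    (h : (k + 2) * k = p * q * b ^ 2) : k % 2 = 0 := by
  by_contra hk
  have hk1 : k % 2 = 1 := by omega
  have hco : (k + 2).Coprime k := by
    rw [add_comm, Nat.coprime_add_self_left]
    exact Nat.coprime_two_left.2 (Nat.odd_iff.2 hk1)
  have hpq : p * q % 8 = 3 := by simp [Nat.mul_mod, hp8, hq8]
  obtain ⟨u, v, s, t, huv, hs, ht, -⟩ := hco.exists_eq_mul_sq (Nat.mul_pos hp.pos hq.pos) h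
  have hs2 : s % 2 = 1 := by
    rcases Nat.mod_two_eq_zero_or_one s with h0 | h0
    · have := Nat.mul_mod u (s ^ 2) 2
      simp [Nat.pow_mod, h0] at this
      omega
    · exact h0
  have ht2 : t % 2 = 1 := by
    rcases Nat.mod_two_eq_zero_or_one t with h0 | h0
    · have := Nat.mul_mod v (t ^ 2) 2
      simp [Nat.pow_mod, h0] at this
      omega
    · exact h0
  have hs8 := Nat.mul_sq_mod_eight_of_odd hs2 u
  have ht8 := Nat.mul_sq_mod_eight_of_odd ht2 v
  rcases hp.eq_of_mul_eq_mul hq huv with ⟨rfl, rfl⟩ | ⟨rfl, rfl⟩ | ⟨rfl, rfl⟩ | ⟨rfl, rfl⟩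
  · omega
  · have hz : ((p * q * s ^ 2 : ℕ) : ZMod p) = ((1 * t ^ 2 + 2 : ℕ) : ZMod p) := by
      rw [← hs, ← ht]
    push_cast at hz
    rw [CharP.cast_eq_zero] at hz
    exact hp.not_isSquare_neg_two (Or.inl hp8) ⟨t, by linear_combination hz⟩
  · omega
  · obtain ⟨r, hr⟩ := hsq
    have hz : ((u * s ^ 2 : ℕ) : ZMod u) = ((v * t ^ 2 + 2 : ℕ) : ZMod u) := by
      rw [← hs, ← ht]
    push_cast at hz
    rw [CharP.cast_eq_zero] at hz
    exact hq.not_isSquare_neg_two (Or.inr hq8)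
      ⟨r * t, by linear_combination hz + (t : ZMod u) ^ 2 * hr⟩

/-- Let `p ≡ 5 (mod 8)` and `q ≡ 7 (mod 8)` be primes with Legendre symbol `(p/q) = 1`.
Write the fundamental unit of `ℚ(√(pq))` as `ε_{pq} = a + b√(pq)` with `a, b`
positive integers.  Then there exist integers `b₁, b₂` with `a + 1 = 2p·b₁²` and
`a - 1 = 2q·b₂²`; in particular `1 = p·b₁² - q·b₂²` and `(b₁√p + b₂√q)² = ε_{pq}`
in `ℝ`. -/
theorem statement_3 (p q : ℕ) (hp : p.Prime) (hq : q.Prime)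
    (hp8 : p % 8 = 5) (hq8 : q % 8 = 7)
    (hleg : @legendreSym q ⟨hq⟩ (p : ℤ) = 1)
    (a b : ℕ) (ha : 0 < a) (hb : 0 < b)
    (hfund : IsFundamentalUnit (p * q)
      ((a : ℝ) + (b : ℝ) * Real.sqrt (p * q))) :
    ∃ b₁ b₂ : ℤ,
      (a : ℤ) + 1 = 2 * p * b₁ ^ 2 ∧
      (a : ℤ) - 1 = 2 * q * b₂ ^ 2 ∧
      (1 : ℤ) = p * b₁ ^ 2 - q * b₂ ^ 2 ∧
      ((b₁ : ℝ) * Real.sqrt p + (b₂ : ℝ) * Real.sqrt q) ^ 2 =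
        (a : ℝ) + (b : ℝ) * Real.sqrt (p * q) := by
  have hpq : p * q % 8 = 3 := by simp [Nat.mul_mod, hp8, hq8]
  have hpq0 : 0 < p * q := Nat.mul_pos hp.pos hq.pos
  rw [← Nat.cast_mul] at hfund
  have hpell := hfund.1.pell (by omega)
  have hsq : IsSquare (p : ZMod q) := by
    have := Fact.mk hq
    by_contra hns
    rw [(legendreSym.eq_neg_one_iff' q).2 hns] at hleg
    norm_num at hleg
  obtain ⟨k, rfl⟩ : ∃ k, a = k + 1 := ⟨a - 1, by omega⟩
  have hk : (k + 2) * k = p * q * b ^ 2 := by linarith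
  obtain ⟨j, rfl⟩ : ∃ j, k = 2 * j :=
    ⟨k / 2, by have := even_of_mul_add_two_eq hp hq hp8 hq8 hsq hk; omega⟩
  obtain ⟨c, rfl⟩ : 2 ∣ b := by
    have hb2 : b ^ 2 % 2 = 0 := by
      have h1 : p * q * b ^ 2 % 2 = 0 := by
        rw [← hk, show (2 * j + 2) * (2 * j) = 2 * ((2 * j + 2) * j) by ring]
        simp
      have hodd : p * q % 2 = 1 := by omega
      simpa [Nat.mul_mod _ (b ^ 2), hodd] using h1
    exact Nat.prime_two.dvd_of_dvd_pow (Nat.dvd_of_mod_eq_zero hb2)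
  have hj : (j + 1) * j = p * q * c ^ 2 := by linarith
  have hco : (j + 1).Coprime j := by simp
  obtain ⟨u, v, s, t, huv, hs, ht, rfl⟩ := hco.exists_eq_mul_sq hpq0 hj
  have ht0 : 0 < t := Nat.pos_of_ne_zero (by rintro rfl; simp at hb)
  rcases hp.eq_of_mul_eq_mul hq huv with ⟨rfl, rfl⟩ | ⟨rfl, rfl⟩ | ⟨rfl, rfl⟩ | ⟨rfl, rfl⟩
  · exact (hfund.not_sq hpq0 ht0 (s := s) (by linarith) (by linarith) rfl).elim
  · exact absurd (by rw [← hs, ← ht]) (Nat.mul_sq_ne_mul_sq_add_one (by omega) rfl s t)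
  · have hs' : (j : ℤ) + 1 = u * (s : ℤ) ^ 2 := by exact_mod_cast hs
    have ht' : (j : ℤ) = v * (t : ℤ) ^ 2 := by exact_mod_cast ht
    refine ⟨s, t, ?_, ?_, ?_, ?_⟩
    · push_cast; linear_combination 2 * hs'
    · push_cast; linear_combination 2 * ht'
    · linear_combination hs' - ht'
    · have hsr : (j : ℝ) + 1 = u * (s : ℝ) ^ 2 := by exact_mod_cast hs
      have htr : (j : ℝ) = v * (t : ℝ) ^ 2 := by exact_mod_cast ht
      rw [Real.sqrt_mul (Nat.cast_nonneg u)]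
      push_cast
      linear_combination (s : ℝ) ^ 2 * Real.sq_sqrt (Nat.cast_nonneg (α := ℝ) u) +
        (t : ℝ) ^ 2 * Real.sq_sqrt (Nat.cast_nonneg (α := ℝ) v) - hsr - htr
  · exact absurd (by rw [← hs, ← ht]) (Nat.mul_sq_ne_mul_sq_add_one (u := u) (v := v)
      (by omega) (by omega) s t)
end
end

section
/- Let q and s be primes with q ≡ 7 (mod 8) and s ≡ 3 (mod 8). Then the class number of the real biquadratic field ℚ(√2, √(qs)) is odd, i.e., its 2-class number equals 1. -/
open Real NumberField IntermediateField

noncomputable section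

theorem Squarefree.dvd_of_forall_prime_dvd {A : Type*} [CommRing A] [IsDomain A]
    [UniqueFactorizationMonoid A] {c d : A} (hc : Squarefree c) (hc0 : c ≠ 0)
    (h : ∀ p, Prime p → p ∣ c → p ∣ d) : c ∣ d := by
  induction c using UniqueFactorizationMonoid.induction_on_prime generalizing d with
  | h₁ => exact absurd rfl hc0
  | h₂ x hx => exact hx.dvd
  | h₃ a p ha hp ih =>
    obtain ⟨d', rfl⟩ := h p hp (dvd_mul_right _ _)
    refine mul_dvd_mul_left p (ih (hc.squarefree_of_dvd (dvd_mul_left _ _)) ha fun q hq hqa => ?_)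
    refine (hq.dvd_or_dvd (h q hq (hqa.mul_left _))).resolve_left fun hqp => ?_
    have hpq : p ∣ a := ((hq.associated_of_dvd hp hqp).symm.dvd).trans hqa
    exact hp.not_isUnit (hc p (mul_dvd_mul_left p hpq))

theorem Ideal.eq_of_sq_eq_sq {O : Type*} [CommRing O] [IsDedekindDomain O] {I J : Ideal O}
    (hI : I ≠ ⊥) (hJ : J ≠ ⊥) (h : I ^ 2 = J ^ 2) : I = J := by
  have h1 := congrArg UniqueFactorizationMonoid.normalizedFactors h
  rw [UniqueFactorizationMonoid.normalizedFactors_pow,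
    UniqueFactorizationMonoid.normalizedFactors_pow] at h1
  have h2 := nsmul_right_injective two_ne_zero h1
  rw [← associated_iff_eq]
  exact (UniqueFactorizationMonoid.associated_iff_normalizedFactors_eq_normalizedFactors hI hJ).2 h2

/-- The ring homomorphism `j` identifies `A` with the subring of `O` fixed by the involution `σ`. -/
structure IsInvolutionFixedRing {A O : Type*} [CommRing A] [CommRing O]
    (j : A →+* O) (σ : O ≃+* O) : Prop where
  injective : Function.Injective j
  involutive : ∀ x, σ (σ x) = x
  fixes : ∀ a, σ (j a) = j a
  exists_eq_of_fixed : ∀ x, σ x = x → ∃ a, j a = x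

namespace IsInvolutionFixedRing

variable {A O : Type*} [CommRing A] [CommRing O] {j : A →+* O} {σ : O ≃+* O}

theorem exists_norm (h : IsInvolutionFixedRing j σ) (x : O) : ∃ a, j a = x * σ x :=
  h.exists_eq_of_fixed _ (by rw [map_mul, h.involutive, mul_comm])

theorem exists_trace (h : IsInvolutionFixedRing j σ) (x : O) : ∃ a, j a = x + σ x :=
  h.exists_eq_of_fixed _ (by rw [map_add, h.involutive, add_comm])

theorem exists_unit_eq (h : IsInvolutionFixedRing j σ) (u : Oˣ) (hu : σ u = u) :
    ∃ a : Aˣ, Units.map (j : A →* O) a = u := by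
  obtain ⟨a, ha⟩ := h.exists_eq_of_fixed u hu
  have hinv : σ (↑u⁻¹ : O) = ↑u⁻¹ := by
    have h1 : σ (↑u⁻¹ : O) * (u : O) = 1 := by
      conv_lhs => rw [← hu]
      rw [← map_mul]; simp
    exact (Units.mul_eq_one_iff_eq_inv).1 h1
  obtain ⟨b, hb⟩ := h.exists_eq_of_fixed _ hinv
  have hab : a * b = 1 := h.injective (by rw [map_mul, ha, hb]; simp)
  exact ⟨⟨a, b, hab, by rw [mul_comm, hab]⟩, Units.ext ha⟩

theorem dvd_of_map_dvd [IsDomain O] (h : IsInvolutionFixedRing j σ) {a b : A} (ha : a ≠ 0)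
    (hab : j a ∣ j b) : a ∣ b := by
  obtain ⟨y, hy⟩ := hab
  have hja : j a ≠ 0 := by rwa [Ne, map_eq_zero_iff j h.injective]
  obtain ⟨c, rfl⟩ := h.exists_eq_of_fixed y (by
    apply mul_left_cancel₀ hja
    rw [← hy, ← h.fixes a, ← map_mul, ← hy, h.fixes])
  exact ⟨c, h.injective (by rw [hy, map_mul])⟩

/-- An element whose trace and norm are divisible by `g` and `g ^ 2` is divisible by `g`. -/
theorem dvd_of_dvd_trace_of_sq_dvd_norm [IsDomain O] [IsIntegrallyClosed O]
    {x g t n : O} (hg : g ≠ 0) (hx : x ^ 2 - g * t * x + g ^ 2 * n = 0) : g ∣ x := by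
  have hg' : algebraMap O (FractionRing O) g ≠ 0 := by
    rwa [Ne, map_eq_zero_iff _ (IsFractionRing.injective O (FractionRing O))]
  have hint : IsIntegral O (algebraMap O (FractionRing O) x / algebraMap O (FractionRing O) g) := by
    refine ⟨Polynomial.X ^ 2 - Polynomial.C t * Polynomial.X + Polynomial.C n, ?_, ?_⟩
    · monicity!
    · have := congrArg (algebraMap O (FractionRing O)) hx
      simp only [map_add, map_sub, map_mul, map_pow, map_zero] at this
      simp only [Polynomial.eval₂_add, Polynomial.eval₂_sub, Polynomial.eval₂_mul,
        Polynomial.eval₂_pow, Polynomial.eval₂_X, Polynomial.eval₂_C]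
      field_simp
      linear_combination this
  obtain ⟨y, hy⟩ := IsIntegrallyClosed.isIntegral_iff.1 hint
  refine ⟨y, IsFractionRing.injective O (FractionRing O) ?_⟩
  rw [map_mul, hy]
  field_simp

/-- The product of an ideal with its conjugate is generated by an element of the fixed ring. -/
theorem exists_span_eq_mul_map [IsDomain O] [IsIntegrallyClosed O] [IsDomain A]
    [IsPrincipalIdealRing A]
    (h : IsInvolutionFixedRing j σ) (I : Ideal O) (hI : I ≠ ⊥) :
    ∃ g : A, g ≠ 0 ∧ I * I.map (σ : O →+* O) = Ideal.span {j g} := by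
  obtain ⟨g, hg⟩ := (IsPrincipalIdealRing.principal ((I * I.map (σ : O →+* O)).comap j)).principal
  rw [← Ideal.span] at hg
  have hconj : ∀ y ∈ I, σ y ∈ I.map (σ : O →+* O) := fun y hy =>
    Ideal.mem_map_of_mem (σ : O →+* O) hy
  have hmem : ∀ a : A, j a ∈ I * I.map (σ : O →+* O) ↔ g ∣ a := fun a => by
    rw [← Ideal.mem_span_singleton, ← hg, Ideal.mem_comap]
  have hnorm : ∀ x ∈ I, ∀ a, j a = x * σ x → g ∣ a := fun x hx a ha => by
    rw [← hmem, ha]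
    exact Ideal.mul_mem_mul hx (hconj x hx)
  have hg0 : g ≠ 0 := by
    rintro rfl
    obtain ⟨x, hx, hx0⟩ := Submodule.exists_mem_ne_zero_of_ne_bot hI
    obtain ⟨a, ha⟩ := h.exists_norm x
    have h0 : a = 0 := by simpa using hnorm x hx a ha
    rw [h0, map_zero, eq_comm, mul_eq_zero] at ha
    simp [hx0] at ha
  refine ⟨g, hg0, le_antisymm (Ideal.mul_le.2 fun x hx z hz => ?_) ?_⟩
  · obtain ⟨y, hy, rfl⟩ := (Ideal.mem_map_of_equiv σ z).1 hz
    rw [Ideal.mem_span_singleton]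
    obtain ⟨t, ht⟩ := h.exists_trace (x * σ y)
    obtain ⟨a, ha⟩ := h.exists_norm x
    obtain ⟨b, hb⟩ := h.exists_norm y
    obtain ⟨a', rfl⟩ := hnorm x hx a ha
    obtain ⟨b', rfl⟩ := hnorm y hy b hb
    obtain ⟨t', rfl⟩ : g ∣ t := by
      rw [← hmem, ht, map_mul, h.involutive, mul_comm (σ x)]
      exact add_mem (Ideal.mul_mem_mul hx (hconj y hy)) (Ideal.mul_mem_mul hy (hconj x hx))
    rw [map_mul] at ht ha hb
    rw [map_mul, h.involutive] at ht
    refine dvd_of_dvd_trace_of_sq_dvd_norm (t := j t') (n := j a' * j b')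
      (by rwa [Ne, map_eq_zero_iff j h.injective]) ?_
    linear_combination (-x * σ y) * ht + (j g * j b') * ha + x * σ x * hb
  · rw [Ideal.span_singleton_le_iff_mem, hmem]

/-- A form of Hilbert 90. -/
theorem exists_hilbert90 [IsDomain O] (h : IsInvolutionFixedRing j σ) {θ : O} (hθ : θ ≠ 0)
    (hσθ : σ θ = -θ) {γ : O} {n : A} (hγ : γ * σ γ = j n ^ 2) :
    ∃ β, β ≠ 0 ∧ γ * σ β = j n * β := by
  by_cases h0 : γ + j n = 0
  · refine ⟨θ, hθ, ?_⟩
    rw [hσθ, eq_neg_of_add_eq_zero_left h0]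
    ring
  · refine ⟨γ + j n, h0, ?_⟩
    rw [map_add, h.fixes]
    linear_combination hγ

/-- Away from the discriminant `d`, the extension is unramified. -/
theorem dvd_of_dvd_sq [IsDomain O] [IsDomain A] [IsPrincipalIdealRing A]
    (h : IsInvolutionFixedRing j σ) {w : O} {d : A}
    (hw : σ w = 1 - w) (hd : j d = (2 * w - 1) ^ 2) {p : A} (hp : Prime p) (hpd : ¬ p ∣ d)
    {x : O} (hx : j p ∣ x ^ 2) : j p ∣ x := by
  have htrace : ∀ y : O, j p ∣ y ^ 2 → j p ∣ y + σ y := by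
    rintro y ⟨z, hz⟩
    obtain ⟨t, ht⟩ := h.exists_trace y
    obtain ⟨n, hn⟩ := h.exists_norm y
    obtain ⟨t', ht'⟩ := h.exists_trace z
    obtain ⟨n', hn'⟩ := h.exists_norm z
    have hσz : σ y ^ 2 = j p * σ z := by rw [← map_pow, hz, map_mul, h.fixes]
    have h1 : p ∣ n := by
      refine hp.dvd_of_dvd_pow (n := 2) ⟨p * n', h.injective ?_⟩
      simp only [map_mul, map_pow, hn, hn']
      linear_combination σ y ^ 2 * hz + j p * z * hσz
    have h2 : p ∣ t := by
      obtain ⟨m, rfl⟩ := h1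
      refine hp.dvd_of_dvd_pow (n := 2) ⟨t' + 2 * m, h.injective ?_⟩
      simp only [map_mul, map_pow, map_add, map_ofNat, ht, ht'] at hn ⊢
      linear_combination hz + hσz - 2 * hn
    rw [← ht]
    exact map_dvd j h2
  have h1 := htrace x hx
  have h2 := htrace (x * w) (by rw [mul_pow]; exact hx.mul_right _)
  have h3 : j p ∣ j d * x := by
    have : j d * x = (2 * w - 1) * ((x * w + σ (x * w)) - (1 - w) * (x + σ x)) := by
      rw [hd, map_mul, hw]; ring
    rw [this]
    exact (dvd_sub h2 (h1.mul_left _)).mul_left _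
  obtain ⟨a, b, hab⟩ := (hp.irreducible.coprime_iff_not_dvd).2 hpd
  have h4 : x = j p * (j a * x) + j b * (j d * x) := by
    have := congrArg j hab
    simp only [map_add, map_mul, map_one] at this
    linear_combination (-x) * this
  rw [h4]
  exact dvd_add (dvd_mul_right _ _) (h3.mul_left _)

/-- If `c` generates the square of an ideal upstairs, then `c` is a divisor of the discriminant up
to squares. -/
theorem exists_eq_sq_mul_dvd [IsDedekindDomain O] [IsDomain A] [IsPrincipalIdealRing A]
    (h : IsInvolutionFixedRing j σ) {w : O} {d : A}
    (hw : σ w = 1 - w) (hd : j d = (2 * w - 1) ^ 2) (c : A) (hc : c ≠ 0) (I : Ideal O)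
    (hI : I ^ 2 = Ideal.span {j c}) : ∃ r t : A, c = r ^ 2 * t ∧ t ∣ d := by
  induction c using (wellFounded_dvdNotUnit (α := A)).induction generalizing I with
  | _ c ih =>
  by_cases hcd : c ∣ d
  · exact ⟨1, c, by ring, hcd⟩
  obtain ⟨p, hp, hpc, hp'⟩ : ∃ p, Prime p ∧ p ∣ c ∧ (p ^ 2 ∣ c ∨ ¬ p ∣ d) := by
    by_contra! hcon
    apply hcd
    have hsq : Squarefree c := by
      refine (squarefree_iff_no_irreducibles hc).2 fun p hp hpp => ?_
      exact (hcon p hp.prime (dvd_of_mul_left_dvd hpp)).1 (by rwa [sq])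
    exact hsq.dvd_of_forall_prime_dvd hc fun p hp hpc => (hcon p hp hpc).2
  have hjp : j p ≠ 0 := by rw [Ne, map_eq_zero_iff j h.injective]; exact hp.ne_zero
  have hIp : I ≤ Ideal.span {j p} := by
    intro x hx
    have hx2 : x ^ 2 ∈ Ideal.span {j c} := hI ▸ Ideal.pow_mem_pow hx 2
    rw [Ideal.mem_span_singleton] at hx2 ⊢
    rcases hp' with hp' | hp'
    · refine (IsIntegrallyClosed.pow_dvd_pow_iff two_ne_zero).1 ?_
      rw [← map_pow]
      exact (map_dvd j hp').trans hx2
    · exact h.dvd_of_dvd_sq hw hd hp hp' ((map_dvd j hpc).trans hx2)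
  obtain ⟨J, rfl⟩ := Ideal.dvd_iff_le.2 hIp
  have hpc2 : p ^ 2 ∣ c := by
    apply h.dvd_of_map_dvd (pow_ne_zero 2 hp.ne_zero)
    have hle : Ideal.span {j c} ≤ Ideal.span {j (p ^ 2)} := by
      rw [← hI, mul_pow, Ideal.span_singleton_pow, map_pow]
      exact Ideal.mul_le_left (I := Ideal.span {j p ^ 2}) (J := J ^ 2)
    exact Ideal.span_singleton_le_span_singleton.1 hle
  obtain ⟨c', rfl⟩ := hpc2
  have hc' : c' ≠ 0 := right_ne_zero_of_mul hc
  obtain ⟨r, t, hrt, htd⟩ := ih c' ⟨hc', p ^ 2, fun hu => hp.not_isUnit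
    ((isUnit_pow_iff two_ne_zero).1 hu), mul_comm _ _⟩ hc' J (by
      rw [mul_pow, Ideal.span_singleton_pow, map_mul, map_pow,
        ← Ideal.span_singleton_mul_span_singleton] at hI
      refine mul_left_cancel₀ (a := Ideal.span {j p ^ 2}) ?_ hI
      rw [Ne, Ideal.zero_eq_bot, Ideal.span_singleton_eq_bot]
      exact pow_ne_zero 2 hjp)
  exact ⟨p * r, t, by rw [hrt]; ring, htd⟩

theorem exists_associated_prod_of_dvd [IsDomain A] [IsPrincipalIdealRing A] {p : Fin 3 → A}
    (hp : ∀ i, Irreducible (p i)) {t : A} (ht : t ∣ p 0 * p 1 * p 2) :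
    ∃ (f : Fin 3 → Bool) (e : Aˣ), t = e * ∏ i, if f i then p i else 1 := by
  have key : ∀ i, ∀ a, a ∣ p i → ∃ (b : Bool) (e : Aˣ), a = e * if b then p i else 1 := by
    rintro i a ⟨c, hc⟩
    rcases (hp i).isUnit_or_isUnit hc with ⟨u, rfl⟩ | ⟨u, rfl⟩
    · exact ⟨false, u, by simp⟩
    · exact ⟨true, u⁻¹, by simp [hc, mul_left_comm]⟩
  obtain ⟨t01, t2, h01, h2, rfl⟩ := exists_dvd_and_dvd_of_dvd_mul ht
  obtain ⟨t0, t1, h0, h1, rfl⟩ := exists_dvd_and_dvd_of_dvd_mul h01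
  obtain ⟨b0, e0, rfl⟩ := key 0 _ h0
  obtain ⟨b1, e1, rfl⟩ := key 1 _ h1
  obtain ⟨b2, e2, rfl⟩ := key 2 _ h2
  refine ⟨![b0, b1, b2], e0 * e1 * e2, ?_⟩
  simp only [Fin.prod_univ_three, Units.val_mul, Matrix.cons_val_zero, Matrix.cons_val_one,
    Matrix.cons_val]
  cases b0 <;> cases b1 <;> cases b2 <;> simp <;> ring

/-- The counting step: when `O` has at least `16` units modulo squares, every divisor of the
discriminant is, up to units and squares, the norm of an element `β` with `β ^ 2` an associate
of that norm. -/
theorem exists_sq_associated_of_units [IsDedekindDomain O] [IsDomain A]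
    [IsPrincipalIdealRing A] (h : IsInvolutionFixedRing j σ) {w : O} {p : Fin 3 → A}
    (hw : σ w = 1 - w) (hd : j (p 0 * p 1 * p 2) = (2 * w - 1) ^ 2) (hp : ∀ i, Irreducible (p i))
    (ε : Aˣ)
    (hnorm : ∀ (η : Aˣ) (x y : O), y ≠ 0 → x * σ x = j η * (y * σ y) →
      ∃ (b : Bool) (δ : Aˣ), η = ((if b then ε else 1) * δ ^ 2) ^ 2)
    {ι : Type*} [Fintype ι] (hι : Fintype.card ι = 16) (U : ι → Oˣ)
    (hU : ∀ a b, IsSquare (U a * U b) → a = b) {t : A} (ht : t ∣ p 0 * p 1 * p 2) :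
    ∃ (β : O) (r : A) (e : Aˣ) (u : Oˣ), r ≠ 0 ∧ β ^ 2 = u * j (r ^ 2 * (e * t)) := by
  have hd0 : p 0 * p 1 * p 2 ≠ 0 :=
    mul_ne_zero (mul_ne_zero (hp 0).ne_zero (hp 1).ne_zero) (hp 2).ne_zero
  have hθ : 2 * w - 1 ≠ 0 := by
    intro h0
    rw [h0, zero_pow two_ne_zero, map_eq_zero_iff j h.injective] at hd
    exact hd0 hd
  have hσθ : σ (2 * w - 1) = -(2 * w - 1) := by
    rw [map_sub, map_mul, hw, map_one, map_ofNat]; ring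
  have hlabel : ∀ u : Oˣ, ∃ (l : Bool × (Fin 3 → Bool)) (δ e : Aˣ) (u' : Oˣ) (β : O) (r : A),
      β ≠ 0 ∧ (u : O) = j ((if l.1 then ε else 1) * δ ^ 2 : Aˣ) * u' ∧ u' * σ β = β ∧
      β * σ β = j (r ^ 2 * (e * ∏ i, if l.2 i then p i else 1)) := by
    intro u
    obtain ⟨η, hη⟩ := h.exists_unit_eq (u * Units.map (σ : O →* O) u) (by
      simp [h.involutive, mul_comm])
    have hη' : j η = u * σ u := by simpa using congrArg Units.val hη
    obtain ⟨b, δ, hbδ⟩ := hnorm η u 1 one_ne_zero (by simp [hη'])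
    set D : Aˣ := (if b then ε else 1) * δ ^ 2 with hD
    let u' : Oˣ := Units.map (j : A →* O) D⁻¹ * u
    have hu' : (u' : O) = j (D⁻¹ : Aˣ) * u := rfl
    have hDD : j (D : A) * j (D⁻¹ : Aˣ) = 1 := by rw [← map_mul]; simp
    have hDη : j η = j D ^ 2 := by rw [hbδ]; simp
    obtain ⟨β, hβ, hββ⟩ := h.exists_hilbert90 hθ hσθ (γ := (u' : O)) (n := 1) (by
      rw [hu', map_mul, h.fixes, map_one]
      linear_combination (-j (D⁻¹ : Aˣ) ^ 2) * hη' + j (D⁻¹ : Aˣ) ^ 2 * hDη +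
        (j (D : A) * j (D⁻¹ : Aˣ) + 1) * hDD)
    rw [map_one, one_mul] at hββ
    obtain ⟨c, hc⟩ := h.exists_norm β
    have hσβ : σ β ≠ 0 := by simpa using hβ
    have hc0 : c ≠ 0 := by
      rintro rfl
      rw [map_zero, eq_comm, mul_eq_zero] at hc
      tauto
    have hβc : β ^ 2 = u' * j c := by
      rw [hc]; linear_combination (-β) * hββ
    obtain ⟨r, t, rfl, htd⟩ := h.exists_eq_sq_mul_dvd hw hd c hc0 (Ideal.span {β}) (by
      rw [Ideal.span_singleton_pow, hβc, Ideal.span_singleton_mul_left_unit u'.isUnit])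
    obtain ⟨f, e, rfl⟩ := exists_associated_prod_of_dvd hp htd
    refine ⟨(b, f), δ, e, u', β, r, hβ, ?_, hββ, hc.symm⟩
    rw [hu']
    linear_combination (-(u : O)) * hDD
  choose l δ e u' β r hβ hu hβu hN using hlabel
  have hr : ∀ u, r u ≠ 0 := by
    intro u h0
    have := hN u
    rw [h0] at this
    simp [hβ u] at this
  have hinj : Function.Injective fun a => l (U a) := by
    intro a b hab
    apply hU
    simp only at hab
    have hNa := hN (U a)
    have hNb := hN (U b)
    have hua := hu (U a)
    have hub := hu (U b)
    have hβa := hβu (U a)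
    have hβb := hβu (U b)
    have hra := hr (U a)
    have hrb := hr (U b)
    rw [← hab] at hNb hub
    generalize U a = x at *
    generalize U b = y at *
    set P : A := ∏ i, if (l x).2 i then p i else 1 with hP
    set D : Aˣ := if (l x).1 then ε else 1 with hD
    have hP0 : P ≠ 0 := by
      refine Finset.prod_ne_zero_iff.2 fun i _ => ?_
      split_ifs
      exacts [(hp i).ne_zero, one_ne_zero]
    set R : A := r x * r y * P with hR
    have hR0 : j R ≠ 0 := by
      rw [Ne, map_eq_zero_iff j h.injective]
      exact mul_ne_zero (mul_ne_zero hra hrb) hP0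
    set E : Aˣ := e x * e y with hE
    have hNN : (β x * β y) * σ (β x * β y) = j R ^ 2 * j E := by
      simp only [hR, hE, map_mul, map_pow, Units.val_mul] at hNa hNb ⊢
      linear_combination (β y * σ (β y)) * hNa +
        (j (r x) ^ 2 * (j (e x) * j P)) * hNb
    have hsq : (β x * β y) ^ 2 = (u' x * u' y * Units.map (j : A →* O) E : Oˣ) * j R ^ 2 := by
      simp only [map_mul, Units.val_mul, Units.coe_map, MonoidHom.coe_coe] at hNN ⊢
      linear_combination (-β x * β y ^ 2) * hβa - (β x * β y * u' x * σ (β x)) * hβb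
        + (u' x * u' y : O) * hNN
    obtain ⟨v, hv⟩ : j R ∣ β x * β y :=
      (IsIntegrallyClosed.pow_dvd_pow_iff two_ne_zero).1 (Dvd.intro_left _ hsq.symm)
    have hv2 : v ^ 2 = (u' x * u' y * Units.map (j : A →* O) E : Oˣ) := by
      apply mul_right_cancel₀ (pow_ne_zero 2 hR0)
      rw [← hsq, hv]; ring
    have hvN : v * σ v = j E := by
      apply mul_left_cancel₀ (pow_ne_zero 2 hR0)
      rw [← hNN, hv, map_mul σ, h.fixes]; ring
    obtain ⟨b, δ', hE'⟩ := hnorm E v 1 one_ne_zero (by simp [hvN])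
    have hvu : IsUnit v := (isUnit_pow_iff two_ne_zero).1 (hv2 ▸ Units.isUnit _)
    obtain ⟨V, rfl⟩ := hvu
    generalize ((if b then ε else 1) * δ' ^ 2 : Aˣ) = Δ at hE'
    have hVsq : V ^ 2 = u' x * u' y * Units.map (j : A →* O) Δ ^ 2 := by
      apply Units.ext
      rw [← map_pow, ← hE', ← hv2]; simp
    have hx : x = Units.map (j : A →* O) (D * δ x ^ 2) * u' x := Units.ext hua
    have hy : y = Units.map (j : A →* O) (D * δ y ^ 2) * u' y := Units.ext hub
    refine ⟨V * (Units.map (j : A →* O) Δ)⁻¹ * Units.map (j : A →* O) (D * δ x * δ y), ?_⟩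
    have hmain : u' x * u' y = (V * (Units.map (j : A →* O) Δ)⁻¹) ^ 2 := by
      rw [mul_pow, hVsq]; group
    calc x * y = (u' x * u' y) * Units.map (j : A →* O) (D * δ x * δ y) ^ 2 := by
          conv_lhs => rw [hx, hy]
          simp only [map_mul, map_pow, mul_pow]
          simp only [pow_two, mul_comm, mul_left_comm, mul_assoc]
      _ = _ := by rw [hmain, ← mul_pow, sq]
  have hcard : Fintype.card ι = Fintype.card (Bool × (Fin 3 → Bool)) := by
    rw [hι]; simp
  have hsurj := ((Fintype.bijective_iff_injective_and_card _).2 ⟨hinj, hcard⟩).2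
  obtain ⟨f, e', rfl⟩ := exists_associated_prod_of_dvd hp ht
  obtain ⟨a, ha⟩ := hsurj (false, f)
  simp only at ha
  have hNa := hN (U a)
  rw [ha] at hNa
  refine ⟨β (U a), r (U a), e (U a) * e'⁻¹, u' (U a), hr _, ?_⟩
  have : ((e (U a) * e'⁻¹ : Aˣ) : A) * (e' * ∏ i, if f i then p i else 1) =
      e (U a) * ∏ i, if f i then p i else 1 := by
    rw [← mul_assoc, ← Units.val_mul, inv_mul_cancel_right]
  rw [this, ← hNa]
  linear_combination (-β (U a)) * hβu (U a)

/-- Ideals whose square is principal are principal. -/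
theorem isPrincipal_of_isPrincipal_sq [IsDedekindDomain O] [IsDomain A]
    [IsPrincipalIdealRing A] (h : IsInvolutionFixedRing j σ) {w : O} {p : Fin 3 → A}
    (hw : σ w = 1 - w) (hd : j (p 0 * p 1 * p 2) = (2 * w - 1) ^ 2) (hp : ∀ i, Irreducible (p i))
    (ε : Aˣ)
    (hnorm : ∀ (η : Aˣ) (x y : O), y ≠ 0 → x * σ x = j η * (y * σ y) →
      ∃ (b : Bool) (δ : Aˣ), η = ((if b then ε else 1) * δ ^ 2) ^ 2)
    {ι : Type*} [Fintype ι] (hι : Fintype.card ι = 16) (U : ι → Oˣ)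
    (hU : ∀ a b, IsSquare (U a * U b) → a = b) {I : Ideal O} (hI : I ≠ ⊥) {γ : O}
    (hIγ : I ^ 2 = Ideal.span {γ}) :
    ∃ x y : O, x ≠ 0 ∧ Ideal.span {x} * I = Ideal.span {y} := by
  have hd0 : p 0 * p 1 * p 2 ≠ 0 :=
    mul_ne_zero (mul_ne_zero (hp 0).ne_zero (hp 1).ne_zero) (hp 2).ne_zero
  have hθ : 2 * w - 1 ≠ 0 := by
    intro h0
    rw [h0, zero_pow two_ne_zero, map_eq_zero_iff j h.injective] at hd
    exact hd0 hd
  have hσθ : σ (2 * w - 1) = -(2 * w - 1) := by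
    rw [map_sub, map_mul, hw, map_one, map_ofNat]; ring
  have hγ : γ ≠ 0 := by
    rintro rfl
    rw [Ideal.span_singleton_zero] at hIγ
    exact hI (by simpa using pow_eq_zero_iff (two_ne_zero) |>.1 (hIγ.trans Ideal.zero_eq_bot.symm))
  obtain ⟨g, hg0, hg⟩ := h.exists_span_eq_mul_map I hI
  have hjg : j g ≠ 0 := by rwa [Ne, map_eq_zero_iff j h.injective]
  obtain ⟨u, hu⟩ : Associated (j g ^ 2) (γ * σ γ) := by
    rw [← Ideal.span_singleton_eq_span_singleton, ← Ideal.span_singleton_pow, ← hg, mul_pow, hIγ,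
      ← Ideal.map_pow, hIγ, Ideal.map_span, Set.image_singleton,
      Ideal.span_singleton_mul_span_singleton]
    rfl
  obtain ⟨η, hη⟩ := h.exists_unit_eq u (by
    apply mul_left_cancel₀ (pow_ne_zero 2 hjg)
    have := congrArg σ hu
    rw [map_mul, map_pow, h.fixes, map_mul, h.involutive] at this
    rw [this, hu, mul_comm])
  have hη' : j η = u := by simpa using congrArg Units.val hη
  obtain ⟨b, δ, hbδ⟩ := hnorm η γ (j g) hjg (by rw [h.fixes, hη', ← hu]; ring)
  generalize ((if b then ε else 1) * δ ^ 2 : Aˣ) = D at hbδ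
  obtain ⟨β, hβ, hββ⟩ := h.exists_hilbert90 hθ hσθ (γ := γ) (n := g * D) (by
    rw [← hu, ← hη', hbδ]; simp; ring)
  have hσβ : σ β ≠ 0 := by simpa using hβ
  obtain ⟨m, hm⟩ := h.exists_norm β
  have hm0 : m ≠ 0 := by
    rintro rfl
    rw [map_zero, eq_comm, mul_eq_zero] at hm
    tauto
  have hsq : (Ideal.span {σ β} * I) ^ 2 = Ideal.span {j (g * D * m)} := by
    rw [mul_pow, hIγ, Ideal.span_singleton_pow, Ideal.span_singleton_mul_span_singleton]
    congr 2
    rw [map_mul _ _ m, hm]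
    linear_combination σ β * hββ
  obtain ⟨r, t, hrt, htd⟩ := h.exists_eq_sq_mul_dvd hw hd (g * D * m)
    (mul_ne_zero (mul_ne_zero hg0 D.ne_zero) hm0) _ hsq
  obtain ⟨β', r', e, u', hr', hβ'⟩ :=
    h.exists_sq_associated_of_units hw hd hp ε hnorm hι U hU htd
  have hjr' : j r' ≠ 0 := by rwa [Ne, map_eq_zero_iff j h.injective]
  refine ⟨j r' * σ β, j r * β', mul_ne_zero hjr' hσβ, ?_⟩
  have key : (Ideal.span {j r' * σ β} * I) ^ 2 = Ideal.span {j r * β'} ^ 2 := by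
    rw [← Ideal.span_singleton_mul_span_singleton, mul_assoc, mul_pow, hsq, hrt,
      Ideal.span_singleton_pow, Ideal.span_singleton_pow, Ideal.span_singleton_mul_span_singleton,
      mul_pow, hβ', Ideal.span_singleton_eq_span_singleton]
    refine ⟨u' * Units.map (j : A →* O) e, ?_⟩
    simp only [map_mul, map_pow, Units.val_mul, Units.coe_map, MonoidHom.coe_coe]
    ring
  have hne : Ideal.span {j r' * σ β} * I ≠ ⊥ := by
    rw [← Ideal.zero_eq_bot]
    refine mul_ne_zero ?_ (by rwa [Ideal.zero_eq_bot])
    rw [Ideal.zero_eq_bot, Ne, Ideal.span_singleton_eq_bot]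
    exact mul_ne_zero hjr' hσβ
  refine Ideal.eq_of_sq_eq_sq hne (fun h0 => hne ?_) key
  rw [h0, ← Ideal.zero_eq_bot, zero_pow two_ne_zero] at key
  rw [← Ideal.zero_eq_bot]
  exact (pow_eq_zero_iff two_ne_zero).1 key

end IsInvolutionFixedRing

theorem odd_card_classGroup {O : Type*} [CommRing O] [IsDedekindDomain O] [Finite (ClassGroup O)]
    (h : ∀ (I : Ideal O) (γ : O), I ≠ ⊥ → I ^ 2 = Ideal.span {γ} →
      ∃ x y : O, x ≠ 0 ∧ Ideal.span {x} * I = Ideal.span {y}) :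
    Odd (Nat.card (ClassGroup O)) := by
  rw [← Nat.not_even_iff_odd, even_iff_two_dvd]
  intro h2
  have hF : Fact (Nat.Prime 2) := ⟨Nat.prime_two⟩
  obtain ⟨c, hc⟩ := exists_prime_orderOf_dvd_card' 2 h2
  obtain ⟨I, rfl⟩ := ClassGroup.mk0_surjective c
  have hI : (I : Ideal O) ≠ ⊥ := by
    rw [← Ideal.zero_eq_bot]
    exact nonZeroDivisors.coe_ne_zero I
  have hpow : ClassGroup.mk0 (I ^ 2) = 1 := by
    have := pow_orderOf_eq_one (ClassGroup.mk0 I)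
    rwa [hc, ← map_pow] at this
  have hpr : Submodule.IsPrincipal ((I ^ 2 : nonZeroDivisors (Ideal O)) : Ideal O) :=
    (ClassGroup.mk0_eq_one_iff (I ^ 2).2).1 hpow
  obtain ⟨γ, hγ⟩ := hpr.principal
  obtain ⟨x, y, hx, hxy⟩ := h I γ hI hγ
  have hy : y ≠ 0 := by
    rintro rfl
    rw [Ideal.span_singleton_zero, ← Ideal.zero_eq_bot, mul_eq_zero, Ideal.zero_eq_bot,
      Ideal.span_singleton_eq_bot] at hxy
    tauto
  have h1 : ClassGroup.mk0 I = ClassGroup.mk0 1 :=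
    ClassGroup.mk0_eq_mk0_iff.2 ⟨x, y, hx, hy, by rw [hxy, Submonoid.coe_one, mul_one]⟩
  rw [h1, map_one, orderOf_one] at hc
  exact absurd hc (by norm_num)

theorem eq_zero_of_sq_eq_mul_sq {F : Type*} [Field F] {c : F} (hc : ¬ IsSquare c) {a b : F}
    (h : a ^ 2 = c * b ^ 2) : a = 0 ∧ b = 0 := by
  have hb : b = 0 := by
    by_contra hb
    exact hc ⟨a / b, by field_simp; linear_combination -h⟩
  subst hb
  simpa using h

theorem Int.dvd_of_dvd_sq_sub_mul_sq {p : ℕ} [Fact p.Prime] {c : ℤ} (hc : ¬ IsSquare (c : ZMod p))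
    {a b : ℤ} (h : (p : ℤ) ∣ a ^ 2 - c * b ^ 2) : (p : ℤ) ∣ a ∧ (p : ℤ) ∣ b := by
  simp only [← ZMod.intCast_zmod_eq_zero_iff_dvd] at h ⊢
  push_cast at h
  exact eq_zero_of_sq_eq_mul_sq hc (sub_eq_zero.1 h)

theorem Int.dvd_of_dvd_sq_add_sq {p : ℕ} [Fact p.Prime] (hp : p % 4 = 3)
    {a b : ℤ} (h : (p : ℤ) ∣ a ^ 2 + b ^ 2) : (p : ℤ) ∣ a ∧ (p : ℤ) ∣ b := by
  refine Int.dvd_of_dvd_sq_sub_mul_sq (c := -1) ?_ (by simpa using h)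
  rw [Int.cast_neg, Int.cast_one, ZMod.exists_sq_eq_neg_one_iff]
  exact fun h => h hp

namespace Zsqrtd

theorem two_ne_mul_self (n : ℤ) : 2 ≠ n * n := by
  intro h
  have h1 : n < 2 := by nlinarith
  have h2 : -2 < n := by nlinarith
  interval_cases n <;> omega

theorem norm_two_eq_zero {a : ℤ√2} : a.norm = 0 ↔ a = 0 := norm_eq_zero two_ne_mul_self a

instance isDomain_two : IsDomain (ℤ√2) :=
  have : NoZeroDivisors (ℤ√2) := ⟨fun {a b} h => by
    simpa only [norm_mul, norm_zero, _root_.mul_eq_zero, norm_two_eq_zero] using congrArg norm h⟩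
  NoZeroDivisors.to_isDomain _

/-- `ℤ√2` is norm-Euclidean. -/
theorem exists_natAbs_norm_sub_mul_lt (x : ℤ√2) {y : ℤ√2} (hy : y ≠ 0) :
    ∃ t : ℤ√2, (x - y * t).norm.natAbs < y.norm.natAbs := by
  have hround : ∀ a n : ℤ, n ≠ 0 → ∃ k, 2 * |a - n * k| ≤ |n| := by
    intro a n hn
    refine ⟨round (a / n : ℚ), ?_⟩
    have h1 := abs_sub_round (a / n : ℚ)
    have hn' : (n : ℚ) ≠ 0 := by exact_mod_cast hn
    have h2 : ((a - n * round (a / n : ℚ) : ℤ) : ℚ) = n * (a / n - round (a / n : ℚ)) := by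
      push_cast; field_simp
    have h3 : (2 * |a - n * round (a / n : ℚ)| : ℚ) ≤ |(n : ℚ)| := by
      have h2' := congrArg abs h2
      rw [abs_mul] at h2'
      push_cast at h2' ⊢
      rw [h2']
      nlinarith [abs_nonneg (n : ℚ)]
    exact_mod_cast h3
  have hn : y.norm ≠ 0 := by rwa [Ne, norm_two_eq_zero]
  obtain ⟨k, hk⟩ := hround (x * star y).re y.norm hn
  obtain ⟨l, hl⟩ := hround (x * star y).im y.norm hn
  refine ⟨⟨k, l⟩, ?_⟩
  have hmul : (x - y * ⟨k, l⟩).norm * y.norm = ((x * star y).re - y.norm * k) ^ 2 -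
      2 * ((x * star y).im - y.norm * l) ^ 2 := by
    simp only [norm_def, re_mul, im_mul, re_star, im_star, re_sub, im_sub]
    ring
  zify
  refine lt_of_mul_lt_mul_right ?_ (abs_nonneg y.norm)
  rw [← abs_mul, hmul, abs_lt]
  have h1 : 0 < |y.norm| := abs_pos.2 hn
  have h2 := sq_abs ((x * star y).re - y.norm * k)
  have h3 := sq_abs ((x * star y).im - y.norm * l)
  have h4 := abs_nonneg ((x * star y).re - y.norm * k)
  have h5 := abs_nonneg ((x * star y).im - y.norm * l)
  constructor <;> nlinarith

instance isPrincipalIdealRing_two : IsPrincipalIdealRing (ℤ√2) := ⟨fun I => by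
  by_cases hI : I = ⊥
  · rw [hI]; exact bot_isPrincipal
  obtain ⟨y₀, hy₀, hy₀'⟩ := Submodule.exists_mem_ne_zero_of_ne_bot hI
  obtain ⟨y, ⟨hy, hy'⟩, hmin⟩ := (measure fun z : ℤ√2 => z.norm.natAbs).wf.has_min
    {z | z ∈ I ∧ z ≠ 0} ⟨y₀, hy₀, hy₀'⟩
  refine ⟨y, _root_.le_antisymm (fun x hx => ?_) ((Ideal.span_singleton_le_iff_mem I).2 hy)⟩
  obtain ⟨t, ht⟩ := exists_natAbs_norm_sub_mul_lt x hy'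
  have h0 : x - y * t = 0 := by
    by_contra h0
    exact hmin _ ⟨I.sub_mem hx (I.mul_mem_right t hy), h0⟩ ht
  exact Ideal.mem_span_singleton.2 ⟨t, sub_eq_zero.1 h0⟩⟩

/-- The fundamental unit `1 + √2`. -/
def fundUnitTwo : (ℤ√2)ˣ where
  val := ⟨1, 1⟩
  inv := ⟨-1, 1⟩
  val_inv := by ext <;> simp
  inv_val := by ext <;> simp

theorem exists_eq_zpow_of_norm_eq_one (η : (ℤ√2)ˣ) (hη : (η : ℤ√2).norm = 1) :
    ∃ m : ℤ, η = (fundUnitTwo ^ m) ^ 2 ∨ η = -(fundUnitTwo ^ m) ^ 2 := by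
  have hfund : Pell.IsFundamental (Pell.Solution₁.mk (d := 2) 3 2 (by norm_num)) := by
    refine ⟨by simp, by simp, fun {b} hb => ?_⟩
    have hp := b.prop
    simp only [Pell.Solution₁.x_mk]
    by_contra! hlt
    have hx : b.x = 2 := by omega
    rw [hx] at hp
    omega
  let f : Pell.Solution₁ 2 →* (ℤ√2)ˣ := Unitary.toUnits
  have hf : ∀ a : Pell.Solution₁ 2, (f a : ℤ√2) = (a : ℤ√2) := fun a => rfl
  obtain ⟨m, hm⟩ := hfund.eq_zpow_or_neg_zpow ⟨(η : ℤ√2), norm_eq_one_iff_mem_unitary.1 hη⟩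
  have h1 : f (Pell.Solution₁.mk (d := 2) 3 2 (by norm_num)) = fundUnitTwo ^ 2 := by
    ext <;> simp [hf, fundUnitTwo, pow_two]
  have h2 : f ⟨(η : ℤ√2), norm_eq_one_iff_mem_unitary.1 hη⟩ = η := Units.ext rfl
  have h3 : ∀ a, f (-a) = -f a := fun a => Units.ext rfl
  refine ⟨m, ?_⟩
  rw [← zpow_natCast, zpow_comm]
  rcases hm with hm | hm
  · left
    rw [← h2, hm, map_zpow, h1, zpow_natCast]
  · right
    rw [← h2, hm, h3, map_zpow, h1, zpow_natCast]

theorem exists_eq_zpow_mul_sq (m : ℤ) :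
    ∃ (b : Bool) (δ : (ℤ√2)ˣ), fundUnitTwo ^ m = (if b then fundUnitTwo else 1) * δ ^ 2 := by
  rcases Int.even_or_odd' m with ⟨k, rfl | rfl⟩
  · exact ⟨false, fundUnitTwo ^ k, by rw [← zpow_natCast, ← zpow_mul]; simp [mul_comm]⟩
  · exact ⟨true, fundUnitTwo ^ k, by
      rw [← zpow_natCast, ← zpow_mul, if_pos rfl, ← zpow_one_add]; congr 1; push_cast; ring⟩

theorem not_isSquare_two_of_mod_eight_eq_three {s : ℕ} [Fact s.Prime] (hs : s % 8 = 3) :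
    ¬ IsSquare ((2 : ℤ) : ZMod s) := by
  push_cast
  rw [ZMod.exists_sq_eq_two_iff (by rintro rfl; omega)]
  omega

theorem natCast_dvd_of_dvd_norm {s : ℕ} [Fact s.Prime] (hs : s % 8 = 3) {x : ℤ√2}
    (h : (s : ℤ) ∣ x.norm) : (s : ℤ√2) ∣ x := by
  have := Int.dvd_of_dvd_sq_sub_mul_sq (not_isSquare_two_of_mod_eight_eq_three hs)
    (a := x.re) (b := x.im) (by rw [norm_def] at h; convert h using 1; ring)
  exact_mod_cast (intCast_dvd _ _).2 this

theorem not_isUnit_natCast {q : ℕ} (hp : q.Prime) : ¬ IsUnit (q : ℤ√2) := by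
  rw [isUnit_iff_norm_isUnit, norm_natCast]
  exact fun hu => (Nat.prime_iff_prime_int.1 hp).not_isUnit (isUnit_of_mul_isUnit_left hu)

theorem prime_natCast_of_mod_eight_eq_three {s : ℕ} [Fact s.Prime] (hs : s % 8 = 3) :
    Prime (s : ℤ√2) := by
  have hp : s.Prime := Fact.out
  refine ⟨by exact_mod_cast hp.ne_zero, not_isUnit_natCast hp, fun a b hab => ?_⟩
  · have h1 : (s : ℤ) ∣ a.norm * b.norm := by
      obtain ⟨c, hc⟩ := hab
      rw [← norm_mul, hc, norm_mul, norm_natCast, mul_assoc]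
      exact dvd_mul_right _ _
    exact ((Nat.prime_iff_prime_int.1 hp).dvd_or_dvd h1).imp (natCast_dvd_of_dvd_norm hs)
      (natCast_dvd_of_dvd_norm hs)

theorem exists_irreducible_mul_irreducible_eq {q : ℕ} [Fact q.Prime] (hq : q % 8 = 7) :
    ∃ a b : ℤ√2, Irreducible a ∧ Irreducible b ∧ a * b = q := by
  have hp : q.Prime := Fact.out
  obtain ⟨r, hr⟩ := (ZMod.exists_sq_eq_two_iff (p := q) (by rintro rfl; omega)).2 (Or.inr hq)
  obtain ⟨r, rfl⟩ := ZMod.intCast_surjective r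
  have hrq : (q : ℤ) ∣ r * r - 2 := by
    rw [← ZMod.intCast_zmod_eq_zero_iff_dvd]
    push_cast
    rw [hr, sub_self]
  have hnot : ∀ e : ℤ, e.natAbs = 1 → ¬ (q : ℤ√2) ∣ ⟨r, e⟩ := by
    intro e he h
    have := ((intCast_dvd (q : ℤ) _).1 (by exact_mod_cast h)).2
    simp only at this
    have h1 := Int.natAbs_dvd_natAbs.2 this
    rw [he, Int.natAbs_natCast, Nat.dvd_one] at h1
    exact hp.one_lt.ne' h1
  have hnp : ¬ Prime (q : ℤ√2) := by
    intro hpr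
    have hdvd : (q : ℤ√2) ∣ ⟨r, 1⟩ * ⟨r, -1⟩ := by
      have : ((q : ℤ) : ℤ√2) ∣ ⟨r, 1⟩ * ⟨r, -1⟩ := by
        rw [intCast_dvd]
        simp only [re_mul, im_mul]
        exact ⟨by convert hrq using 1; ring, by ring_nf; exact dvd_zero _⟩
      exact_mod_cast this
    rcases hpr.dvd_or_dvd hdvd with h | h
    · exact hnot 1 rfl h
    · exact hnot (-1) rfl h
  rw [← irreducible_iff_prime, irreducible_iff] at hnp
  push Not at hnp
  obtain ⟨a, b, hab, ha, hb⟩ := hnp (not_isUnit_natCast hp)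
  have hN : a.norm.natAbs * b.norm.natAbs = q * q := by
    rw [← Int.natAbs_mul, ← norm_mul, ← hab, norm_natCast, Int.natAbs_mul, Int.natAbs_natCast]
  rw [← norm_eq_one_iff] at ha hb
  have hNq := (Nat.Prime.mul_eq_prime_sq_iff hp ha hb).1 (by rw [hN, sq])
  have hirr : ∀ c : ℤ√2, c.norm.natAbs = q → Irreducible c := by
    intro c hc
    refine ⟨fun hu => hp.one_lt.ne' (by rw [← hc]; exact norm_eq_one_iff.2 hu), fun x y hxy => ?_⟩
    rw [hxy, norm_mul, Int.natAbs_mul] at hc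
    rw [← norm_eq_one_iff, ← norm_eq_one_iff]
    rcases (hc ▸ hp : Nat.Prime _) |> Nat.prime_mul_iff.1 with h | h
    · exact Or.inr h.2
    · exact Or.inl h.2
  exact ⟨a, b, hirr a hNq.1, hirr b hNq.2, hab.symm⟩

end Zsqrtd

theorem pow_dvd_of_norm_form_eq {A : Type*} [CommRing A] [IsDomain A] {P m η : A} (hP0 : P ≠ 0)
    (hm : ∀ z, P ∣ m * z → P ∣ z) (hη : ∀ x y, P ∣ x ^ 2 - η * y ^ 2 → P ∣ x ∧ P ∣ y)
    (k : ℕ) {a b a' b' : A}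
    (h : P * m * a ^ 2 - b ^ 2 = η * (P * m * a' ^ 2 - b' ^ 2)) : P ^ k ∣ a' ∧ P ^ k ∣ b' := by
  induction k generalizing a b a' b' with
  | zero => simp
  | succ k ih =>
    obtain ⟨⟨b, rfl⟩, ⟨b', rfl⟩⟩ := hη b b' ⟨m * a ^ 2 - η * m * a' ^ 2, by linear_combination -h⟩
    obtain ⟨⟨a, rfl⟩, ⟨a', rfl⟩⟩ := hη a a' (hm _ ⟨b ^ 2 - η * b' ^ 2,
      mul_left_cancel₀ hP0 (by linear_combination h)⟩)
    obtain ⟨h1, h2⟩ := ih (a := a) (b := b) (a' := a') (b' := b')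
      (mul_left_cancel₀ (pow_ne_zero 2 hP0) (by linear_combination h))
    rw [pow_succ']
    exact ⟨mul_dvd_mul_left P h1, mul_dvd_mul_left P h2⟩

theorem eq_zero_of_norm_form_eq {A : Type*} [CommRing A] [IsDomain A] [IsPrincipalIdealRing A]
    {P m η : A} (hP0 : P ≠ 0) (hPu : ¬ IsUnit P)
    (hm : ∀ z, P ∣ m * z → P ∣ z) (hη : ∀ x y, P ∣ x ^ 2 - η * y ^ 2 → P ∣ x ∧ P ∣ y)
    {a b a' b' : A}
    (h : P * m * a ^ 2 - b ^ 2 = η * (P * m * a' ^ 2 - b' ^ 2)) : a' = 0 ∧ b' = 0 := by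
  have key : ∀ z, (∀ k, P ^ k ∣ z) → z = 0 := by
    intro z hz
    by_contra h0
    obtain ⟨n, hn⟩ := FiniteMultiplicity.of_not_isUnit hPu h0
    exact hn (hz _)
  exact ⟨key _ fun k => (pow_dvd_of_norm_form_eq hP0 hm hη k h).1,
    key _ fun k => (pow_dvd_of_norm_form_eq hP0 hm hη k h).2⟩

namespace Zsqrtd

theorem natCast_dvd_of_dvd_mul {p q : ℕ} (h : Nat.Coprime p q) (z : ℤ√2)
    (hz : (p : ℤ√2) ∣ q * z) : (p : ℤ√2) ∣ z := by
  have : IsCoprime (p : ℤ√2) (q : ℤ√2) := by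
    exact_mod_cast (Nat.isCoprime_iff_coprime.2 h).map (Int.castRingHom (ℤ√2))
  exact this.dvd_of_dvd_mul_left hz

theorem dvd_and_dvd_of_norm_eq_neg_one {s : ℕ} [Fact s.Prime] (hs : s % 8 = 3) {η : ℤ√2}
    (hη : η.norm = -1) {x y : ℤ√2} (h : (s : ℤ√2) ∣ x ^ 2 - η * y ^ 2) :
    (s : ℤ√2) ∣ x ∧ (s : ℤ√2) ∣ y := by
  obtain ⟨z, hz⟩ := h
  have hN : (s : ℤ) ∣ x.norm ^ 2 + y.norm ^ 2 := by
    have h1 : (x ^ 2).norm = (η * y ^ 2 + s * z).norm := by rw [← hz]; congr 1; ring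
    have h2 : (η * y ^ 2 + s * z).norm = (η * y ^ 2).norm + s * (2 * ((η * y ^ 2).re * z.re) -
        4 * ((η * y ^ 2).im * z.im) + s * z.norm) := by
      generalize η * y ^ 2 = v
      simp only [norm_def, re_add, im_add, re_mul, im_mul, re_natCast, im_natCast]
      ring
    rw [h2, norm_mul, hη, sq, sq, norm_mul, norm_mul] at h1
    exact ⟨2 * ((η * (y * y)).re * z.re) - 4 * ((η * (y * y)).im * z.im) + s * z.norm,
      by linear_combination h1⟩
  obtain ⟨h1, h2⟩ := Int.dvd_of_dvd_sq_add_sq (by omega) hN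
  exact ⟨natCast_dvd_of_dvd_norm hs h1, natCast_dvd_of_dvd_norm hs h2⟩

theorem dvd_and_dvd_of_dvd_sq_add_sq {q : ℕ} [Fact q.Prime] (hq : q % 8 = 7) {x y : ℤ√2}
    (h : (q : ℤ√2) ∣ x ^ 2 + y ^ 2) : (q : ℤ√2) ∣ x ∧ (q : ℤ√2) ∣ y := by
  obtain ⟨r, hr⟩ := (ZMod.exists_sq_eq_two_iff (p := q) (by rintro rfl; omega)).2 (Or.inr hq)
  have h2 : (2 : ZMod q) ≠ 0 := by
    intro h0
    have : q ∣ 2 := (ZMod.natCast_eq_zero_iff 2 q).1 (by exact_mod_cast h0)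
    have := Nat.le_of_dvd (by norm_num) this
    omega
  have hr0 : r ≠ 0 := by rintro rfl; exact h2 (by simpa using hr)
  have hneg : ¬ IsSquare (-1 : ZMod q) := by
    rw [ZMod.exists_sq_eq_neg_one_iff]; omega
  have hφ : ∀ φ : ℤ√2 →+* ZMod q, φ x = 0 ∧ φ y = 0 := by
    intro φ
    have h0 : φ (x ^ 2 + y ^ 2) = 0 := by
      obtain ⟨z, hz⟩ := h
      rw [hz, map_mul, map_natCast]; simp
    rw [map_add, map_pow, map_pow] at h0
    exact eq_zero_of_sq_eq_mul_sq hneg (by linear_combination h0)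
  have hmem : ∀ z : ℤ√2, (∀ φ : ℤ√2 →+* ZMod q, φ z = 0) → (q : ℤ√2) ∣ z := by
    intro z hz
    have e1 := hz (lift ⟨r, by rw [← hr]; norm_num⟩)
    have e2 := hz (lift ⟨-r, by rw [neg_mul_neg, ← hr]; norm_num⟩)
    simp only [lift_apply_apply] at e1 e2
    have e3 : (z.re : ZMod q) = 0 := mul_left_cancel₀ h2 (by linear_combination e1 + e2)
    have e4 : (z.im : ZMod q) = 0 :=
      mul_left_cancel₀ (mul_ne_zero h2 hr0) (by linear_combination e1 - e2)
    rw [ZMod.intCast_zmod_eq_zero_iff_dvd] at e3 e4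
    exact_mod_cast (intCast_dvd (q : ℤ) z).2 ⟨e3, e4⟩
  exact ⟨hmem x fun φ => (hφ φ).1, hmem y fun φ => (hφ φ).2⟩

/-- A unit of `ℤ√2` that is a quotient of two nonzero norms from `ℚ(√2, √(qs))` is the square of
a unit. -/
theorem unit_eq_sq_of_norm_form_eq {q s : ℕ} [Fact q.Prime] [Fact s.Prime] (hq : q % 8 = 7)
    (hs : s % 8 = 3) (η : (ℤ√2)ˣ) {a b a' b' : ℤ√2} (h0 : ¬ (a' = 0 ∧ b' = 0))
    (h : q * s * a ^ 2 - b ^ 2 = η * (q * s * a' ^ 2 - b' ^ 2)) :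
    ∃ (b : Bool) (δ : (ℤ√2)ˣ), η = ((if b then fundUnitTwo else 1) * δ ^ 2) ^ 2 := by
  have hqp : q.Prime := Fact.out
  have hsp : s.Prime := Fact.out
  have hqs : Nat.Coprime q s := (Nat.coprime_primes hqp hsp).2 (by rintro rfl; omega)
  have hq0 : (q : ℤ√2) ≠ 0 := by exact_mod_cast hqp.ne_zero
  have hs0 : (s : ℤ√2) ≠ 0 := by exact_mod_cast hsp.ne_zero
  have hN : (η : ℤ√2).norm = 1 := by
    rcases Int.natAbs_eq_iff.1 (norm_eq_one_iff.2 η.isUnit) with h1 | h1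
    · exact h1
    · refine absurd (eq_zero_of_norm_form_eq hs0 (not_isUnit_natCast hsp)
        (natCast_dvd_of_dvd_mul hqs.symm)
        (fun x y => dvd_and_dvd_of_norm_eq_neg_one hs h1) (a := a) (b := b) ?_) h0
      linear_combination h
  obtain ⟨m, hm | hm⟩ := exists_eq_zpow_of_norm_eq_one η hN
  · obtain ⟨b, δ, hb⟩ := exists_eq_zpow_mul_sq m
    exact ⟨b, δ, by rw [hm, hb]⟩
  · generalize fundUnitTwo ^ m = ζ at hm
    refine absurd (eq_zero_of_norm_form_eq hq0 (not_isUnit_natCast hqp)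
      (natCast_dvd_of_dvd_mul hqs) (fun x y hxy => ?_) h) h0
    have h1 := dvd_and_dvd_of_dvd_sq_add_sq hq (x := x) (y := ζ * y) (by
      convert hxy using 1
      rw [hm]
      push_cast
      ring)
    exact ⟨h1.1, (Units.dvd_mul_left (u := ζ)).1 h1.2⟩

end Zsqrtd

namespace IsInvolutionFixedRing

theorem unit_eq_sq_of_norm_eq {O : Type*} [CommRing O] [IsDomain O] {j : ℤ√2 →+* O} {σ : O ≃+* O}
    (h : IsInvolutionFixedRing j σ) {q s : ℕ} [Fact q.Prime] [Fact s.Prime] (hq : q % 8 = 7)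
    (hs : s % 8 = 3) {w : O} (hw : σ w = 1 - w) (hd : j (q * s) = (2 * w - 1) ^ 2)
    (η : (ℤ√2)ˣ) (x y : O) (hy : y ≠ 0) (hxy : x * σ x = j η * (y * σ y)) :
    ∃ (b : Bool) (δ : (ℤ√2)ˣ), η = ((if b then Zsqrtd.fundUnitTwo else 1) * δ ^ 2) ^ 2 := by
  have hqp : q.Prime := Fact.out
  have hsp : s.Prime := Fact.out
  have hσθ : σ (2 * w - 1) = -(2 * w - 1) := by
    rw [map_sub, map_mul, hw, map_one, map_ofNat]; ring
  have hform : ∀ z : O, ∃ a b : ℤ√2, j a = z + σ z ∧ j b = (2 * w - 1) * (z - σ z) := by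
    intro z
    obtain ⟨a, ha⟩ := h.exists_trace z
    obtain ⟨b, hb⟩ := h.exists_eq_of_fixed ((2 * w - 1) * (z - σ z)) (by
      rw [map_mul, hσθ, map_sub, h.involutive]; ring)
    exact ⟨a, b, ha, hb⟩
  obtain ⟨a, b, ha, hb⟩ := hform x
  obtain ⟨a', b', ha', hb'⟩ := hform y
  refine Zsqrtd.unit_eq_sq_of_norm_form_eq hq hs η (a := a) (b := b) (a' := a') (b' := b') ?_ ?_
  · rintro ⟨rfl, rfl⟩
    rw [map_zero] at ha' hb'
    have hqs : j (q * s) ≠ 0 := by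
      rw [Ne, map_eq_zero_iff j h.injective]
      exact_mod_cast mul_ne_zero hqp.ne_zero hsp.ne_zero
    have h2 : j 2 ≠ 0 := by
      rw [Ne, map_eq_zero_iff j h.injective]
      exact two_ne_zero
    have : j 2 * (j (q * s) * y) = 0 := by
      rw [hd, map_ofNat]
      linear_combination (-(2 * w - 1) ^ 2) * ha' - (2 * w - 1) * hb'
    exact mul_ne_zero h2 (mul_ne_zero hqs hy) this
  · apply h.injective
    rw [map_sub, map_mul j _ (a ^ 2), map_mul j (η : ℤ√2), map_sub, map_mul j _ (a' ^ 2), hd]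
    simp only [map_pow, ha, hb, ha', hb']
    linear_combination (4 * (2 * w - 1) ^ 2) * hxy

end IsInvolutionFixedRing

theorem Complex.conj_eq_self_of_sq_eq_natCast {z : ℂ} {n : ℕ} (h : z ^ 2 = n) :
    (starRingEnd ℂ) z = z := by
  have h1 : z ^ 2 = ((√n : ℝ) : ℂ) ^ 2 := by
    rw [h, ← Complex.ofReal_pow, Real.sq_sqrt (Nat.cast_nonneg n), Complex.ofReal_natCast]
  rcases sq_eq_sq_iff_eq_or_eq_neg.1 h1 with h2 | h2 <;> simp [h2]

theorem NumberField.Units.exists_units_isSquare_mul {K : Type*} [Field K] [NumberField K]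
    (φ : K →+* ℝ) (hrank : Units.rank K = 3) :
    ∃ U : Bool × (Fin (Units.rank K) → Bool) → (𝓞 K)ˣ,
      Fintype.card (Bool × (Fin (Units.rank K) → Bool)) = 16 ∧
      ∀ a b, IsSquare (U a * U b) → a = b := by
  have hpos : ∀ u : (𝓞 K)ˣ, 0 < φ ((u ^ 2 : (𝓞 K)ˣ) : K) := fun u => by
    have hu : φ (u : K) ≠ 0 := by simp
    have : φ ((u ^ 2 : (𝓞 K)ˣ) : K) = φ (u : K) ^ 2 := by simp
    rw [this]
    positivity
  have hsign : ∀ b : Bool, (if b then -1 else 1 : (𝓞 K)ˣ) ∈ torsion K := by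
    intro b
    rw [torsion, CommGroup.mem_torsion, isOfFinOrder_iff_pow_eq_one]
    exact ⟨2, by norm_num, by split_ifs <;> simp⟩
  refine ⟨fun a => (if a.1 then -1 else 1) *
    ∏ i, fundSystem K i ^ (if a.2 i then 1 else 0 : ℤ), by simp [hrank], ?_⟩
  rintro ⟨s, v⟩ ⟨s', v'⟩ ⟨x, hx⟩
  obtain ⟨⟨ζ, e⟩, hζe, -⟩ := exist_unique_eq_mul_prod K x
  simp only at hζe hx
  set z : (𝓞 K)ˣ := x * x with hz
  have h1 : z = ((if s then -1 else 1) * (if s' then -1 else 1)) *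
      ∏ i, fundSystem K i ^ ((if v i then 1 else 0 : ℤ) + (if v' i then 1 else 0 : ℤ)) := by
    rw [← hx]
    simp only [zpow_add, Finset.prod_mul_distrib]
    exact mul_mul_mul_comm _ _ _ _
  have h2 : z = ((ζ ^ 2 : torsion K) : (𝓞 K)ˣ) * ∏ i, fundSystem K i ^ (2 * e i) := by
    rw [hz, hζe]
    simp only [two_mul, zpow_add, Finset.prod_mul_distrib, pow_two, Subgroup.coe_mul]
    exact mul_mul_mul_comm _ _ _ _
  have h3 := (exist_unique_eq_mul_prod K z).unique (y₁ := (⟨_, mul_mem (hsign s) (hsign s')⟩, _))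
    (y₂ := (ζ ^ 2, fun i => 2 * e i)) h1 h2
  rw [Prod.mk.injEq] at h3
  have h4 : v = v' := by
    funext i
    have := congrFun h3.2 i
    cases hv : v i <;> cases hv' : v' i <;> simp [hv, hv'] at this ⊢ <;> omega
  have h5 := hpos ζ
  rw [← Subgroup.coe_pow, ← h3.1] at h5
  have h6 : s = s' := by
    cases s <;> cases s' <;> first | rfl | (norm_num at h5)
  rw [h4, h6]

/-- Integral elements of `ℚ(√2)` lie in `ℤ[√2]`. -/
theorem QuadraticAlgebra.exists_int_of_isIntegral {z : QuadraticAlgebra ℚ 2 0}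
    (hz : IsIntegral ℤ z) : ∃ m n : ℤ, z.re = m ∧ z.im = n := by
  have hint : ∀ c : ℚ, IsIntegral ℤ (algebraMap ℚ (QuadraticAlgebra ℚ 2 0) c) →
      ∃ m : ℤ, (m : ℚ) = c := by
    intro c hc
    have : IsIntegral ℤ c := by
      obtain ⟨P, hP, hP'⟩ := hc
      refine ⟨P, hP, algebraMap_injective (R := ℚ) (a := 2) (b := 0) ?_⟩
      rw [map_zero, ← hP', Polynomial.hom_eval₂]
      congr 1
    exact IsIntegrallyClosed.isIntegral_iff.1 this
  have hstar : IsIntegral ℤ (star z) := by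
    exact hz.map (starRingEnd (QuadraticAlgebra ℚ 2 0)).toIntAlgHom
  obtain ⟨t, ht⟩ := hint (2 * z.re) (by
    convert hz.add hstar using 1
    ext <;> simp; ring)
  obtain ⟨k, hk⟩ := hint (z.re ^ 2 - 2 * z.im ^ 2) (by
    convert hz.mul hstar using 1
    rw [algebraMap_eq]
    ext <;> simp <;> ring)
  obtain ⟨l, hl⟩ : ∃ l : ℤ, (l : ℚ) = 4 * z.im := by
    refine IsIntegrallyClosed.isIntegral_iff.1 (IsIntegral.of_pow (n := 2) (by norm_num) ?_)
    have : (4 * z.im) ^ 2 = algebraMap ℤ ℚ (2 * (t ^ 2 - 4 * k)) := by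
      simp only [algebraMap_int_eq, eq_intCast]
      push_cast
      rw [ht, hk]
      ring
    rw [this]
    exact isIntegral_algebraMap
  have hrel : l ^ 2 = 2 * (t ^ 2 - 4 * k) := by
    have : (l : ℚ) ^ 2 = 2 * (t ^ 2 - 4 * k) := by rw [hl, ht, hk]; ring
    exact_mod_cast this
  have heven : ∀ c : ℤ, 2 ∣ c ^ 2 → 2 ∣ c := fun c => Int.prime_two.dvd_of_dvd_pow
  obtain ⟨l, rfl⟩ := heven l ⟨_, hrel⟩
  obtain ⟨t, rfl⟩ := heven t ⟨l ^ 2 + 2 * k, by linarith⟩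
  obtain ⟨l, rfl⟩ := heven l ⟨t ^ 2 - k, by linarith⟩
  refine ⟨t, l, ?_, ?_⟩
  · push_cast at ht; linarith
  · push_cast at hl; linarith

instance fact_rat_sq_ne_two : Fact (∀ c : ℚ, c ^ 2 ≠ 2 + 0 * c) := ⟨fun c hc => by
  have h : IsSquare ((2 : ℕ) : ℚ) := ⟨c, by push_cast; linear_combination -hc⟩
  obtain ⟨m, hm⟩ := Rat.isSquare_natCast_iff.1 h
  exact Zsqrtd.two_ne_mul_self m (by exact_mod_cast hm)⟩

section Biquadratic

variable {K : Type*} [Field K] [NumberField K] {q s : ℕ} {r t : K}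

theorem NumberField.isTotallyReal_of_sq_eq {n : ℕ} (hr : r ^ 2 = 2) (ht : t ^ 2 = n)
    (hgen : ∀ x : K, ∃ a b c e : ℚ, x = a + b * r + (c + e * r) * t) : IsTotallyReal K := by
  refine ⟨fun v => ?_⟩
  rw [InfinitePlace.isReal_iff]
  refine RingHom.ext fun x => ?_
  have hr' := Complex.conj_eq_self_of_sq_eq_natCast (z := v.embedding r) (n := 2)
    (by rw [← map_pow, hr, map_ofNat]; norm_num)
  have ht' := Complex.conj_eq_self_of_sq_eq_natCast (z := v.embedding t) (n := n)
    (by rw [← map_pow, ht]; simp)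
  obtain ⟨a, b, c, e, rfl⟩ := hgen x
  simp [ComplexEmbedding.conjugate_coe_eq, hr', ht']

theorem exists_int_of_isIntegral_add_mul_sqrt_two (hr : r ^ 2 = 2) {a b : ℚ}
    (h : IsIntegral ℤ (a + b * r)) : ∃ m n : ℤ, a = m ∧ b = n := by
  let f : QuadraticAlgebra ℚ 2 0 →ₐ[ℚ] K := QuadraticAlgebra.lift ⟨r, by
    rw [← sq, hr, Algebra.smul_def]; simp⟩
  have hf : f ⟨a, b⟩ = a + b * r := by
    change a • (1 : K) + b • r = _
    simp [Algebra.smul_def]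
  rw [← hf] at h
  have h1 : IsIntegral ℤ (⟨a, b⟩ : QuadraticAlgebra ℚ 2 0) :=
    (isIntegral_algHom_iff f.toRingHom.toIntAlgHom f.toRingHom.injective).1 h
  exact QuadraticAlgebra.exists_int_of_isIntegral h1

theorem odd_card_classGroup_of_biquadratic [Fact q.Prime] [Fact s.Prime] (hq : q % 8 = 7)
    (hs : s % 8 = 3) (hK : Module.finrank ℚ K = 4) (φ : K →+* ℝ)
    (hr : r ^ 2 = 2) (ht : t ^ 2 = (q * s : ℕ)) (τ : K ≃+* K) (hτr : τ r = r) (hτt : τ t = -t)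
    (hgen : ∀ x : K, ∃ a b c e : ℚ, x = a + b * r + (c + e * r) * t) :
    Odd (Nat.card (ClassGroup (𝓞 K))) := by
  have hreal := isTotallyReal_of_sq_eq hr ht hgen
  have hrank : Units.rank K = 3 := by
    have := InfinitePlace.card_eq_nrRealPlaces_add_nrComplexPlaces K
    rw [IsTotallyReal.nrComplexPlaces_eq_zero, ← IsTotallyReal.finrank, hK] at this
    rw [Units.rank, this]
  obtain ⟨U, hcard, hU⟩ := Units.exists_units_isSquare_mul φ hrank
  obtain ⟨R, hR⟩ : ∃ R : 𝓞 K, (R : K) = r := ⟨⟨r, .of_pow (n := 2) (by norm_num) (by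
    rw [hr]; exact_mod_cast isIntegral_natCast (R := ℤ) (a := 2))⟩, rfl⟩
  let j : ℤ√2 →+* 𝓞 K := Zsqrtd.lift ⟨R, by
    apply RingOfIntegers.ext
    change (R : K) * R = algebraMap (𝓞 K) K ((2 : ℤ) : 𝓞 K)
    rw [hR, ← sq, hr, map_intCast, Int.cast_ofNat]⟩
  have hj : ∀ z : ℤ√2, (j z : K) = z.re + z.im * r := fun z => by simp [j, hR]
  let σ : 𝓞 K ≃+* 𝓞 K := RingOfIntegers.mapRingEquiv τ
  have hσ : ∀ x : 𝓞 K, (σ x : K) = τ x := fun x => rfl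
  have hfix : IsInvolutionFixedRing j σ := by
    refine ⟨Zsqrtd.lift_injective _ Zsqrtd.two_ne_mul_self,
      fun x => ?_, fun a => ?_, fun x hx => ?_⟩
    · apply RingOfIntegers.ext
      rw [hσ, hσ]
      obtain ⟨a, b, c, e, hx⟩ := hgen x
      simp [hx, hτr, hτt]
    · apply RingOfIntegers.ext
      rw [hσ, hj]
      simp [hτr]
    · obtain ⟨a, b, c, e, hx'⟩ := hgen x
      have h1 : τ (x : K) = x := by rw [← hσ, hx]
      have h2 : (x : K) = a + b * r := by
        rw [hx'] at h1 ⊢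
        simp only [map_add, map_mul, map_ratCast, hτr, hτt] at h1
        linear_combination (-1 / 2 : K) * h1
      obtain ⟨m, n, rfl, rfl⟩ := exists_int_of_isIntegral_add_mul_sqrt_two hr
        (a := a) (b := b) (by rw [← h2]; exact x.isIntegral_coe)
      refine ⟨⟨m, n⟩, RingOfIntegers.ext ?_⟩
      rw [hj, h2]
      simp
  obtain ⟨k, hk⟩ : ∃ k, q * s = 4 * k + 1 := by
    have : q * s % 4 = 1 := by
      rw [Nat.mul_mod, show q % 4 = 3 by omega, show s % 4 = 3 by omega]
    exact ⟨q * s / 4, by omega⟩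
  obtain ⟨w, hwK⟩ : ∃ w : 𝓞 K, (w : K) = (1 + t) / 2 := ⟨⟨(1 + t) / 2,
    Polynomial.X ^ 2 - Polynomial.X - Polynomial.C (k : ℤ), by monicity!, by
    simp only [Polynomial.eval₂_sub, Polynomial.eval₂_pow, Polynomial.eval₂_X,
      Polynomial.eval₂_C]
    rw [hk] at ht
    push_cast at ht
    simp
    linear_combination (1 / 4 : K) * ht⟩, rfl⟩
  have hw : σ w = 1 - w := by
    apply RingOfIntegers.ext
    change τ w = 1 - (w : K)
    rw [hwK]
    simp only [map_div₀, map_add, map_one, hτt, map_ofNat]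
    ring
  have hd : j (q * s) = (2 * w - 1) ^ 2 := by
    apply RingOfIntegers.ext
    simp only [map_mul, map_natCast, map_pow, map_sub, map_one, map_ofNat, hwK]
    push_cast at ht
    linear_combination -ht
  obtain ⟨a, b, ha, hb, hab⟩ := Zsqrtd.exists_irreducible_mul_irreducible_eq hq
  refine odd_card_classGroup fun I γ hI hγ =>
    hfix.isPrincipal_of_isPrincipal_sq (p := ![a, b, (s : ℤ√2)]) hw (by simpa [hab] using hd) ?_
      Zsqrtd.fundUnitTwo (fun η x y hy hxy => hfix.unit_eq_sq_of_norm_eq hq hs hw hd η x y hy hxy)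
      hcard U hU hI hγ
  intro i
  fin_cases i
  exacts [ha, hb, (Zsqrtd.prime_natCast_of_mod_eight_eq_three hs).irreducible]

end Biquadratic

section Model

theorem not_isSquare_prime_mul {p m : ℕ} (hp : p.Prime) (hm : ¬ p ∣ m) : ¬ IsSquare (p * m) := by
  rintro ⟨x, hx⟩
  obtain ⟨y, rfl⟩ : p ∣ x := by simpa using hp.dvd_mul.1 ⟨m, hx.symm⟩
  exact hm ⟨y * y, Nat.eq_of_mul_eq_mul_left hp.pos (by rw [hx]; ring)⟩

theorem QuadraticAlgebra.sq_ne_natCast {n : ℕ} (h1 : ¬ IsSquare n) (h2 : ¬ IsSquare (2 * n))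
    (z : QuadraticAlgebra ℚ 2 0) : z ^ 2 ≠ n + 0 * z := by
  intro h
  have hre := congrArg QuadraticAlgebra.re h
  have him := congrArg QuadraticAlgebra.im h
  simp [sq] at hre him
  have him' : z.re = 0 ∨ z.im = 0 := by
    rw [← mul_eq_zero]; linarith
  rcases him' with h0 | h0
  · refine h2 (Rat.isSquare_natCast_iff.1 ⟨2 * z.im, ?_⟩)
    rw [h0] at hre
    push_cast
    linarith
  · refine h1 (Rat.isSquare_natCast_iff.1 ⟨z.re, ?_⟩)
    rw [h0] at hre
    linarith

/-- The field `ℚ(√2)(√n)`, as an abstract quadratic extension of `ℚ(√2)`. -/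
abbrev BiquadraticModel (n : ℕ) : Type :=
  QuadraticAlgebra (QuadraticAlgebra ℚ 2 0) (n : QuadraticAlgebra ℚ 2 0) 0

theorem finrank_biquadraticModel (n : ℕ) : Module.finrank ℚ (BiquadraticModel n) = 4 := by
  have := Module.finrank_mul_finrank ℚ (QuadraticAlgebra ℚ 2 0) (BiquadraticModel n)
  rw [QuadraticAlgebra.finrank_eq_two, QuadraticAlgebra.finrank_eq_two] at this
  exact this.symm

/-- The real embedding of `ℚ(√2)(√n)` sending the generators to the positive roots. -/
def biquadraticModelToReal (n : ℕ) : BiquadraticModel n →+* ℝ :=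
  let f : QuadraticAlgebra ℚ 2 0 →ₐ[ℚ] ℝ := QuadraticAlgebra.lift ⟨√2, by simp⟩
  letI := f.toRingHom.toAlgebra
  (QuadraticAlgebra.lift ⟨√n, by simp [Algebra.smul_def]⟩ :
    BiquadraticModel n →ₐ[QuadraticAlgebra ℚ 2 0] ℝ).toRingHom

theorem biquadraticModelToReal_apply {n : ℕ} (x : BiquadraticModel n) :
    biquadraticModelToReal n x =
      x.re.re + x.re.im * √2 + (x.im.re + x.im.im * √2) * √n := by
  let f : QuadraticAlgebra ℚ 2 0 →ₐ[ℚ] ℝ := QuadraticAlgebra.lift ⟨√2, by simp⟩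
  have hf : ∀ z, f z = z.re + z.im * √2 := fun z => by
    change z.re • (1 : ℝ) + z.im • √2 = _
    simp [Algebra.smul_def]
  change f x.re * 1 + f x.im * √n = _
  rw [hf, hf, mul_one]

variable (n : ℕ) [Fact (∀ z : QuadraticAlgebra ℚ 2 0, z ^ 2 ≠ n + 0 * z)]

instance : NumberField (BiquadraticModel n) where
  to_finiteDimensional := .of_finrank_pos (by rw [finrank_biquadraticModel]; norm_num)

theorem range_biquadraticModelToReal :
    Set.range (biquadraticModelToReal n) = (adjoin ℚ {√2, √n} : IntermediateField ℚ ℝ) := by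
  apply subset_antisymm
  · rintro _ ⟨x, rfl⟩
    have h2 : √2 ∈ (adjoin ℚ {√2, √n} : IntermediateField ℚ ℝ) := subset_adjoin _ _ (by simp)
    have hn : √n ∈ (adjoin ℚ {√2, √n} : IntermediateField ℚ ℝ) := subset_adjoin _ _ (by simp)
    have hc : ∀ c : ℚ, (c : ℝ) ∈ (adjoin ℚ {√2, √n} : IntermediateField ℚ ℝ) :=
      fun c => IntermediateField.algebraMap_mem _ c
    rw [biquadraticModelToReal_apply]
    exact add_mem (add_mem (hc _) (mul_mem (hc _) h2))
      (mul_mem (add_mem (hc _) (mul_mem (hc _) h2)) hn)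
  · have : adjoin ℚ {√2, √n} ≤ (biquadraticModelToReal n).toRatAlgHom.fieldRange := by
      rw [adjoin_le_iff]
      rintro _ (rfl | rfl)
      · exact ⟨⟨⟨0, 1⟩, 0⟩, (biquadraticModelToReal_apply _).trans (by simp)⟩
      · exact ⟨⟨0, ⟨1, 0⟩⟩, (biquadraticModelToReal_apply _).trans (by simp)⟩
    exact this

theorem odd_card_classGroup_biquadraticModel {q s : ℕ} [Fact q.Prime] [Fact s.Prime]
    (hq : q % 8 = 7) (hs : s % 8 = 3)
    [Fact (∀ z : QuadraticAlgebra ℚ 2 0, z ^ 2 ≠ (q * s : ℕ) + 0 * z)] :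
    Odd (Nat.card (ClassGroup (𝓞 (BiquadraticModel (q * s))))) := by
  refine odd_card_classGroup_of_biquadratic (r := ⟨⟨0, 1⟩, 0⟩) (t := ⟨0, 1⟩) hq hs
    (finrank_biquadraticModel _)
    (biquadraticModelToReal _) ?_ ?_ (starRingAut (R := BiquadraticModel (q * s))) ?_ ?_ fun x => ?_
  · refine (biquadraticModelToReal _).injective ?_
    rw [map_pow, biquadraticModelToReal_apply, map_ofNat]
    simp
  · ext <;> simp [sq]
  · ext <;> simp
  · ext <;> simp
  · refine ⟨x.re.re, x.re.im, x.im.re, x.im.im, ?_⟩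
    ext <;> simp

end Model

/-- Let `q ≡ 7 (mod 8)` and `s ≡ 3 (mod 8)` be primes.  Then the class number of the
real biquadratic field `ℚ(√2, √(qs))` is odd, i.e. its 2-class number equals `1`. -/
theorem statement_5 (q s : ℕ) (hq : q.Prime) (hs : s.Prime)
    (hq8 : q % 8 = 7) (hs8 : s % 8 = 3) :
    Odd (Nat.card (ClassGroup (𝓞 ↥(adjoin ℚ {Real.sqrt 2, Real.sqrt (q * s)} :
      IntermediateField ℚ ℝ)))) := by
  have : Fact q.Prime := ⟨hq⟩
  have : Fact s.Prime := ⟨hs⟩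
  have hqs : ¬ q ∣ s := by
    rw [Nat.prime_dvd_prime_iff_eq hq hs]
    omega
  have hodd : ¬ 2 ∣ q * s := by
    rw [Nat.prime_two.dvd_mul]
    omega
  have : Fact (∀ z : QuadraticAlgebra ℚ 2 0, z ^ 2 ≠ (q * s : ℕ) + 0 * z) :=
    ⟨QuadraticAlgebra.sq_ne_natCast (not_isSquare_prime_mul hq hqs)
      (not_isSquare_prime_mul Nat.prime_two hodd)⟩
  rw [← Nat.cast_mul]
  have hrange := range_biquadraticModelToReal (q * s)
  let f : BiquadraticModel (q * s) →+* ↥(adjoin ℚ {√2, √(q * s : ℕ)} : IntermediateField ℚ ℝ) :=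
    (biquadraticModelToReal (q * s)).codRestrict
      (adjoin ℚ {√2, √(q * s : ℕ)} : IntermediateField ℚ ℝ) fun x => hrange.subset ⟨x, rfl⟩
  have hf : Function.Surjective f := by
    rintro ⟨y, hy⟩
    obtain ⟨x, hx⟩ := hrange.superset hy
    exact ⟨x, Subtype.ext hx⟩
  rw [← Nat.card_congr (ClassGroup.mulEquiv (RingOfIntegers.mapRingEquiv
    (RingEquiv.ofBijective f ⟨f.injective, hf⟩))).toEquiv]
  exact odd_card_classGroup_biquadraticModel hq8 hs8
end
end
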